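/- arXiv:2312.11928 — 3 statements merged into one kernel-verified Lean document; each statement's English description precedes it below -/
import Mathlib

section
/- Let S = ℂ[x,y,z] and let f_Z = xyz(x+y-z)(x-y+z)(2x-2y+z)(2x-y-2z)(2x+y+z)(2x-y-z) be the defining polynomial of Ziegler's arrangement of 9 lines. Then the minimal degree of a Jacobian syzygy for f_Z is 5; that is, there exist homogeneous polynomials a, b, c of degree 5, not all zero, with a·∂f_Z/∂x + b·∂f_Z/∂y + c·∂f_Z/∂z = 0, and no such nonzero triple exists in degree ≤ 4. -/
open MvPolynomial

/-- The defining polynomial of Ziegler's arrangement of 9 lines. -/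
noncomputable def fZ : MvPolynomial (Fin 3) ℂ :=
  (X 0) * (X 1) * (X 2) * (X 0 + X 1 - X 2) * (X 0 - X 1 + X 2) *
  (2 • X 0 - 2 • X 1 + X 2) * (2 • X 0 - X 1 - 2 • X 2) *
  (2 • X 0 + X 1 + X 2) * (2 • X 0 - X 1 - X 2)

namespace Ziegler

/-- A ternary form of degree `n`, evaluated, as an explicit sum over monomials. -/
lemma eval_form (n : ℕ) (a : MvPolynomial (Fin 3) ℂ) (ha : a.IsHomogeneous n) :
    ∃ c : ℕ → ℕ → ℂ, ∀ x y z : ℂ, eval ![x, y, z] a =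
      ∑ i ∈ Finset.range (n + 1), ∑ j ∈ Finset.range (n + 1 - i),
        c i j * (x ^ i * y ^ j * z ^ (n - i - j)) := by
  let m : (Σ _ : ℕ, ℕ) → (Fin 3 →₀ ℕ) := fun s =>
    Finsupp.equivFunOnFinite.symm ![s.1, s.2, n - s.1 - s.2]
  refine ⟨fun i j => a.coeff (m ⟨i, j⟩), fun x y z => ?_⟩
  rw [eval_eq', Finset.sum_sigma']
  have hinj : Function.Injective m := by
    intro s t h
    have h0 := DFunLike.congr_fun h 0
    have h1 := DFunLike.congr_fun h 1
    simp [m] at h0 h1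
    cases s; cases t; simp_all
  have hsub : a.support ⊆ ((Finset.range (n + 1)).sigma
      (fun i => Finset.range (n + 1 - i))).image m := by
    intro d hd
    have hdeg := ha (mem_support_iff.mp hd)
    rw [Finsupp.weight_apply, Finsupp.sum_fintype _ _ (by simp)] at hdeg
    simp [Fin.sum_univ_three] at hdeg
    rw [Finset.mem_image]
    refine ⟨⟨d 0, d 1⟩, ?_, ?_⟩
    · simp; omega
    · ext k
      fin_cases k <;> simp [m]
      omega
  rw [Finset.sum_subset hsub]
  · rw [Finset.sum_image (fun _ _ _ _ h => hinj h)]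
    refine Finset.sum_congr rfl fun s _ => ?_
    simp [m, Fin.prod_univ_three]
  · intro d _ hd
    rw [notMem_support_iff.mp hd, zero_mul]

lemma quartic_zero (e0 e1 e2 e3 e4 : ℂ)
    (h : ∀ t : ℂ, e0 + e1 * t + e2 * t ^ 2 + e3 * t ^ 3 + e4 * t ^ 4 = 0) :
    e0 = 0 ∧ e1 = 0 ∧ e2 = 0 ∧ e3 = 0 ∧ e4 = 0 := by
  have h0 := h 0
  have h1 := h 1
  have h2 := h (-1)
  have h3 := h 2
  have h4 := h (-2)
  norm_num at h0 h1 h2 h3 h4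
  grind

lemma cubic_zero (e0 e1 e2 e3 : ℂ)
    (h1 : e0 + e1 + e2 + e3 = 0) (h2 : e0 - e1 + e2 - e3 = 0)
    (h3 : e0 + 2 * e1 + 4 * e2 + 8 * e3 = 0) (h4 : e0 - 2 * e1 + 4 * e2 - 8 * e3 = 0) :
    e0 = 0 ∧ e1 = 0 ∧ e2 = 0 ∧ e3 = 0 := by
  grind

lemma cubic_zero' (e0 e1 e2 e3 : ℂ)
    (h1 : e0 + e1 + e2 + e3 = 0) (h2 : e0 - e1 + e2 - e3 = 0)
    (h3 : e0 + 2 * e1 + 4 * e2 + 8 * e3 = 0) (h4 : 8 * e0 - 4 * e1 + 2 * e2 - e3 = 0) :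
    e0 = 0 ∧ e1 = 0 ∧ e2 = 0 ∧ e3 = 0 := by
  grind

/-- A conic through the nine listed points vanishes. -/
lemma conic_zero (e1 e2 e3 e4 e5 e6 : ℂ) (Q : ℂ → ℂ → ℂ → ℂ)
    (hQ : ∀ x y z, Q x y z = e1 * x ^ 2 + e2 * (x * y) + e3 * (x * z) + e4 * y ^ 2
      + e5 * (y * z) + e6 * z ^ 2)
    (h1 : Q 1 3 4 = 0) (h2 : Q 2 (-3) (-1) = 0) (h3 : Q 2 1 3 = 0) (h4 : Q 3 4 1 = 0)
    (h5 : Q 2 (-1) (-3) = 0) (h6 : Q 2 3 1 = 0) (h7 : Q 5 6 2 = 0) (h8 : Q 3 4 2 = 0)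
    (h9 : Q 1 (-6) 4 = 0) : ∀ x y z, Q x y z = 0 := by
  rw [hQ] at h1 h2 h3 h4 h5 h6 h7 h8 h9
  norm_num at h1 h2 h3 h4 h5 h6 h7 h8 h9
  have : e1 = 0 ∧ e2 = 0 ∧ e3 = 0 ∧ e4 = 0 ∧ e5 = 0 ∧ e6 = 0 := by grind
  obtain ⟨rfl, rfl, rfl, rfl, rfl, rfl⟩ := this
  intro x y z
  rw [hQ]; ring

/-- A syzygy is tangent to every line of the arrangement. -/
lemma tangent (α β γ u v w x₀ y₀ z₀ : ℂ) (l g a b c : MvPolynomial (Fin 3) ℂ)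
    (hl : l = C α * X 0 + C β * X 1 + C γ * X 2)
    (hf : fZ = l * g) (hu : α * u + β * v + γ * w = 1)
    (h0 : α * x₀ + β * y₀ + γ * z₀ = 0) (hg : eval ![x₀, y₀, z₀] g ≠ 0)
    (hs : a * pderiv 0 fZ + b * pderiv 1 fZ + c * pderiv 2 fZ = 0) :
    ∀ x y z : ℂ, α * x + β * y + γ * z = 0 →
      α * eval ![x, y, z] a + β * eval ![x, y, z] b + γ * eval ![x, y, z] c = 0 := by
  let φ : MvPolynomial (Fin 3) ℂ →ₐ[ℂ] MvPolynomial (Fin 3) ℂ :=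
    aeval (fun i => X i - C (![u, v, w] i) * l)
  have hφl : φ l = 0 := by
    have e : φ l = C α * (X 0 - C u * l) + C β * (X 1 - C v * l) + C γ * (X 2 - C w * l) := by
      conv_lhs => rw [hl]
      simp [φ, algebraMap_eq]
    have e1 : (C α * C u + C β * C v + C γ * C w : MvPolynomial (Fin 3) ℂ) = 1 := by
      rw [← C_mul, ← C_mul, ← C_mul, ← C_add, ← C_add, hu, C_1]
    rw [e]
    linear_combination -hl - l * e1
  have hφe : ∀ x y z : ℂ, α * x + β * y + γ * z = 0 → ∀ p,
      eval ![x, y, z] (φ p) = eval ![x, y, z] p := by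
    intro x y z h p
    have hlz : eval ![x, y, z] l = 0 := by
      rw [hl]; simpa using h
    have : ((eval ![x, y, z]).comp (φ : MvPolynomial (Fin 3) ℂ →+* MvPolynomial (Fin 3) ℂ))
        = eval ![x, y, z] := by
      apply MvPolynomial.ringHom_ext
      · intro r; simp [φ]
      · intro i; simp [φ, hlz]
    exact RingHom.congr_fun this p
  have hφg : φ g ≠ 0 := by
    intro h
    apply hg
    rw [← hφe _ _ _ h0, h, map_zero]
  have hs' : φ (C α * a + C β * b + C γ * c) * φ g = 0 := by
    have d0 : pderiv 0 l = C α := by rw [hl]; simp [pderiv_X]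
    have d1 : pderiv 1 l = C β := by rw [hl]; simp [pderiv_X]
    have d2 : pderiv 2 l = C γ := by rw [hl]; simp [pderiv_X]
    have := congrArg φ hs
    simp only [hf, Derivation.leibniz, smul_eq_mul, d0, d1, d2, map_add, map_mul, map_zero,
      hφl] at this
    simp only [map_add, map_mul]
    linear_combination this
  have h := (mul_eq_zero.mp hs').resolve_right hφg
  intro x y z hxyz
  have := hφe x y z hxyz (C α * a + C β * b + C γ * c)
  rw [h] at this
  simpa using this.symm

lemma fZ_hom : fZ.IsHomogeneous 9 := by
  have hX : ∀ i : Fin 3, (X i : MvPolynomial (Fin 3) ℂ).IsHomogeneous 1 := isHomogeneous_X ℂ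
  have h2 : ∀ i : Fin 3, (2 • X i : MvPolynomial (Fin 3) ℂ).IsHomogeneous 1 := fun i =>
    by rw [two_nsmul]; exact (hX i).add (hX i)
  unfold fZ
  exact (((((((((hX 0).mul (hX 1)).mul (hX 2)).mul (((hX 0).add (hX 1)).sub (hX 2))).mul
    (((hX 0).sub (hX 1)).add (hX 2))).mul (((h2 0).sub (h2 1)).add (hX 2))).mul
    (((h2 0).sub (hX 1)).sub (h2 2))).mul (((h2 0).add (hX 1)).add (hX 2))).mul
    (((h2 0).sub (hX 1)).sub (hX 2)))

lemma fZ_ne : fZ ≠ 0 := by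
  intro h
  have := congrArg (eval ![1, 3, 7]) h
  simp [fZ] at this
  norm_num at this

lemma C_two : (C 2 : MvPolynomial (Fin 3) ℂ) = 2 := map_ofNat C 2

/-- The product rule for `fZ`, evaluated at a point. -/
lemma eval_pderiv (v : Fin 3 → ℂ) (i : Fin 3) : ∀ s : Fin 3 → ℂ, s = Pi.single i 1 →
    eval v (pderiv i fZ) =
    s 0 * (v 1 * v 2 * (v 0 + v 1 - v 2) * (v 0 - v 1 + v 2) * (2 * v 0 - 2 * v 1 + v 2) *
      (2 * v 0 - v 1 - 2 * v 2) * (2 * v 0 + v 1 + v 2) * (2 * v 0 - v 1 - v 2)) +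
    v 0 * (s 1 * (v 2 * (v 0 + v 1 - v 2) * (v 0 - v 1 + v 2) * (2 * v 0 - 2 * v 1 + v 2) *
      (2 * v 0 - v 1 - 2 * v 2) * (2 * v 0 + v 1 + v 2) * (2 * v 0 - v 1 - v 2)) +
    v 1 * (s 2 * ((v 0 + v 1 - v 2) * (v 0 - v 1 + v 2) * (2 * v 0 - 2 * v 1 + v 2) *
      (2 * v 0 - v 1 - 2 * v 2) * (2 * v 0 + v 1 + v 2) * (2 * v 0 - v 1 - v 2)) +
    v 2 * ((s 0 + s 1 - s 2) * ((v 0 - v 1 + v 2) * (2 * v 0 - 2 * v 1 + v 2) *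
      (2 * v 0 - v 1 - 2 * v 2) * (2 * v 0 + v 1 + v 2) * (2 * v 0 - v 1 - v 2)) +
    (v 0 + v 1 - v 2) * ((s 0 - s 1 + s 2) * ((2 * v 0 - 2 * v 1 + v 2) *
      (2 * v 0 - v 1 - 2 * v 2) * (2 * v 0 + v 1 + v 2) * (2 * v 0 - v 1 - v 2)) +
    (v 0 - v 1 + v 2) * ((2 * s 0 - 2 * s 1 + s 2) *
      ((2 * v 0 - v 1 - 2 * v 2) * (2 * v 0 + v 1 + v 2) * (2 * v 0 - v 1 - v 2)) +
    (2 * v 0 - 2 * v 1 + v 2) * ((2 * s 0 - s 1 - 2 * s 2) *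
      ((2 * v 0 + v 1 + v 2) * (2 * v 0 - v 1 - v 2)) +
    (2 * v 0 - v 1 - 2 * v 2) * ((2 * s 0 + s 1 + s 2) * (2 * v 0 - v 1 - v 2) +
      (2 * v 0 + v 1 + v 2) * (2 * s 0 - s 1 - s 2)))))))) := by
  intro s hs
  have hd : ∀ j : Fin 3, eval v (pderiv i (X j : MvPolynomial (Fin 3) ℂ)) = s j := by
    intro j
    rw [hs, pderiv_X]
    by_cases h : i = j
    · subst h; simp
    · simp [Pi.single_apply, h, Ne.symm h]
  unfold fZ
  simp only [Derivation.leibniz, map_add, map_sub, map_nsmul, smul_eq_mul, map_mul, hd, eval_X]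
  simp only [nsmul_eq_mul, Nat.cast_ofNat]
  generalize v 0 = x
  generalize v 1 = y
  generalize v 2 = z
  generalize 2 * x - 2 * y + z = l5
  generalize 2 * x - y - 2 * z = l6
  generalize 2 * x + y + z = l7
  generalize 2 * x - y - z = l8
  generalize x + y - z = l3
  generalize x - y + z = l4
  generalize 2 * s 0 - 2 * s 1 + s 2 = m5
  generalize 2 * s 0 - s 1 - 2 * s 2 = m6
  generalize 2 * s 0 + s 1 + s 2 = m7
  generalize 2 * s 0 - s 1 - s 2 = m8
  generalize s 0 + s 1 - s 2 = m3
  generalize s 0 - s 1 + s 2 = m4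
  ring

lemma tangents (a b c : MvPolynomial (Fin 3) ℂ)
    (hs : a * pderiv 0 fZ + b * pderiv 1 fZ + c * pderiv 2 fZ = 0) :
    (∀ x y z : ℂ, 1 * x + 0 * y + 0 * z = 0 → 1 * eval ![x, y, z] a + 0 * eval ![x, y, z] b
      + 0 * eval ![x, y, z] c = 0) ∧
    (∀ x y z : ℂ, 0 * x + 1 * y + 0 * z = 0 → 0 * eval ![x, y, z] a + 1 * eval ![x, y, z] b
      + 0 * eval ![x, y, z] c = 0) ∧
    (∀ x y z : ℂ, 0 * x + 0 * y + 1 * z = 0 → 0 * eval ![x, y, z] a + 0 * eval ![x, y, z] b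
      + 1 * eval ![x, y, z] c = 0) ∧
    (∀ x y z : ℂ, 1 * x + 1 * y + (-1) * z = 0 → 1 * eval ![x, y, z] a + 1 * eval ![x, y, z] b
      + (-1) * eval ![x, y, z] c = 0) ∧
    (∀ x y z : ℂ, 1 * x + (-1) * y + 1 * z = 0 → 1 * eval ![x, y, z] a + (-1) * eval ![x, y, z] b
      + 1 * eval ![x, y, z] c = 0) ∧
    (∀ x y z : ℂ, 2 * x + (-2) * y + 1 * z = 0 → 2 * eval ![x, y, z] a + (-2) * eval ![x, y, z] b
      + 1 * eval ![x, y, z] c = 0) ∧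
    (∀ x y z : ℂ, 2 * x + (-1) * y + (-2) * z = 0 → 2 * eval ![x, y, z] a + (-1) * eval ![x, y, z] b
      + (-2) * eval ![x, y, z] c = 0) ∧
    (∀ x y z : ℂ, 2 * x + 1 * y + 1 * z = 0 → 2 * eval ![x, y, z] a + 1 * eval ![x, y, z] b
      + 1 * eval ![x, y, z] c = 0) ∧
    (∀ x y z : ℂ, 2 * x + (-1) * y + (-1) * z = 0 → 2 * eval ![x, y, z] a + (-1) * eval ![x, y, z] b
      + (-1) * eval ![x, y, z] c = 0) := by
  refine ⟨?_, ?_, ?_, ?_, ?_, ?_, ?_, ?_, ?_⟩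
  · refine tangent 1 0 0 1 0 0 0 (-2) (-1) (X 0)
      (X 1 * X 2 * (X 0 + X 1 - X 2) * (X 0 - X 1 + X 2) * (2 * X 0 - 2 * X 1 + X 2) * (2 * X 0 - X 1 - 2 * X 2) * (2 * X 0 + X 1 + X 2) * (2 * X 0 - X 1 - X 2))
      a b c ?_ ?_ (by norm_num) (by norm_num) ?_ hs
    · simp [C_two]; try ring
    · simp only [fZ, nsmul_eq_mul, Nat.cast_ofNat]; ring
    · simp; try norm_num
  · refine tangent 0 1 0 0 1 0 (-2) 0 (-1) (X 1)
      (X 0 * X 2 * (X 0 + X 1 - X 2) * (X 0 - X 1 + X 2) * (2 * X 0 - 2 * X 1 + X 2) * (2 * X 0 - X 1 - 2 * X 2) * (2 * X 0 + X 1 + X 2) * (2 * X 0 - X 1 - X 2))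
      a b c ?_ ?_ (by norm_num) (by norm_num) ?_ hs
    · simp [C_two]; try ring
    · simp only [fZ, nsmul_eq_mul, Nat.cast_ofNat]; ring
    · simp; try norm_num
  · refine tangent 0 0 1 0 0 1 (-2) (-1) 0 (X 2)
      (X 0 * X 1 * (X 0 + X 1 - X 2) * (X 0 - X 1 + X 2) * (2 * X 0 - 2 * X 1 + X 2) * (2 * X 0 - X 1 - 2 * X 2) * (2 * X 0 + X 1 + X 2) * (2 * X 0 - X 1 - X 2))
      a b c ?_ ?_ (by norm_num) (by norm_num) ?_ hs
    · simp [C_two]; try ring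
    · simp only [fZ, nsmul_eq_mul, Nat.cast_ofNat]; ring
    · simp; try norm_num
  · refine tangent 1 1 (-1) 0 0 (-1) (-2) 1 (-1) ((X 0 + X 1 - X 2))
      (X 0 * X 1 * X 2 * (X 0 - X 1 + X 2) * (2 * X 0 - 2 * X 1 + X 2) * (2 * X 0 - X 1 - 2 * X 2) * (2 * X 0 + X 1 + X 2) * (2 * X 0 - X 1 - X 2))
      a b c ?_ ?_ (by norm_num) (by norm_num) ?_ hs
    · simp [C_two]; try ring
    · simp only [fZ, nsmul_eq_mul, Nat.cast_ofNat]; ring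
    · simp; try norm_num
  · refine tangent 1 (-1) 1 0 0 1 (-2) (-1) 1 ((X 0 - X 1 + X 2))
      (X 0 * X 1 * X 2 * (X 0 + X 1 - X 2) * (2 * X 0 - 2 * X 1 + X 2) * (2 * X 0 - X 1 - 2 * X 2) * (2 * X 0 + X 1 + X 2) * (2 * X 0 - X 1 - X 2))
      a b c ?_ ?_ (by norm_num) (by norm_num) ?_ hs
    · simp [C_two]; try ring
    · simp only [fZ, nsmul_eq_mul, Nat.cast_ofNat]; ring
    · simp; try norm_num
  · refine tangent 2 (-2) 1 0 0 1 (-2) (-1) 2 ((2 * X 0 - 2 * X 1 + X 2))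
      (X 0 * X 1 * X 2 * (X 0 + X 1 - X 2) * (X 0 - X 1 + X 2) * (2 * X 0 - X 1 - 2 * X 2) * (2 * X 0 + X 1 + X 2) * (2 * X 0 - X 1 - X 2))
      a b c ?_ ?_ (by norm_num) (by norm_num) ?_ hs
    · simp [C_two]; try ring
    · simp only [fZ, nsmul_eq_mul, Nat.cast_ofNat]; ring
    · simp; try norm_num
  · refine tangent 2 (-1) (-2) 0 (-1) 0 (-2) (-2) (-1) ((2 * X 0 - X 1 - 2 * X 2))
      (X 0 * X 1 * X 2 * (X 0 + X 1 - X 2) * (X 0 - X 1 + X 2) * (2 * X 0 - 2 * X 1 + X 2) * (2 * X 0 + X 1 + X 2) * (2 * X 0 - X 1 - X 2))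
      a b c ?_ ?_ (by norm_num) (by norm_num) ?_ hs
    · simp [C_two]; try ring
    · simp only [fZ, nsmul_eq_mul, Nat.cast_ofNat]; ring
    · simp; try norm_num
  · refine tangent 2 1 1 0 0 1 (-1) 1 1 ((2 * X 0 + X 1 + X 2))
      (X 0 * X 1 * X 2 * (X 0 + X 1 - X 2) * (X 0 - X 1 + X 2) * (2 * X 0 - 2 * X 1 + X 2) * (2 * X 0 - X 1 - 2 * X 2) * (2 * X 0 - X 1 - X 2))
      a b c ?_ ?_ (by norm_num) (by norm_num) ?_ hs
    · simp [C_two]; try ring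
    · simp only [fZ, nsmul_eq_mul, Nat.cast_ofNat]; ring
    · simp; try norm_num
  · refine tangent 2 (-1) (-1) 0 0 (-1) (-1) (-1) (-1) ((2 * X 0 - X 1 - X 2))
      (X 0 * X 1 * X 2 * (X 0 + X 1 - X 2) * (X 0 - X 1 + X 2) * (2 * X 0 - 2 * X 1 + X 2) * (2 * X 0 - X 1 - 2 * X 2) * (2 * X 0 + X 1 + X 2))
      a b c ?_ ?_ (by norm_num) (by norm_num) ?_ hs
    · simp [C_two]; try ring
    · simp only [fZ, nsmul_eq_mul, Nat.cast_ofNat]; ring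
    · simp; try norm_num

lemma deg_four (a b c : MvPolynomial (Fin 3) ℂ)
    (ha : a.IsHomogeneous 4) (hb : b.IsHomogeneous 4) (hc : c.IsHomogeneous 4)
    (hs : a * pderiv 0 fZ + b * pderiv 1 fZ + c * pderiv 2 fZ = 0) :
    X 2 * a = X 0 * c ∧ X 2 * b = X 1 * c := by
  obtain ⟨A, hA⟩ := eval_form 4 a ha
  obtain ⟨B, hB⟩ := eval_form 4 b hb
  obtain ⟨D, hD⟩ := eval_form 4 c hc
  simp [Finset.sum_range_succ] at hA hB hD
  obtain ⟨t0, t1, t2, t3, t4, t5, t6, t7, t8⟩ := tangents a b c hs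
  -- divisibility by the coordinates
  obtain ⟨a0, a1, a2, a3, a4⟩ := quartic_zero (A 0 0) (A 0 1) (A 0 2) (A 0 3) (A 0 4) (by
    intro t
    have := t0 0 t 1 (by ring)
    rw [hA] at this
    linear_combination this)
  obtain ⟨b0, b1, b2, b3, b4⟩ := quartic_zero (B 0 0) (B 1 0) (B 2 0) (B 3 0) (B 4 0) (by
    intro t
    have := t1 t 0 1 (by ring)
    rw [hB] at this
    linear_combination this)
  obtain ⟨d0, d1, d2, d3, d4⟩ := quartic_zero (D 0 4) (D 1 3) (D 2 2) (D 3 1) (D 4 0) (by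
    intro t
    have := t2 t 1 0 (by ring)
    rw [hD] at this
    linear_combination this)
  obtain ⟨p, hp⟩ : ∃ p : ℕ → ℕ → ℂ, p = fun i j => A (i + 1) j - D i j := ⟨_, rfl⟩
  obtain ⟨q, hq⟩ : ∃ q : ℕ → ℕ → ℂ, q = fun i j => B i (j + 1) - D i j := ⟨_, rfl⟩
  obtain ⟨R, hR⟩ : ∃ R : ℂ → ℂ → ℂ → ℂ, ∀ x y z, R x y z =
      D 0 0 * z ^ 3 + D 0 1 * (y * z ^ 2) + D 0 2 * (y ^ 2 * z) + D 0 3 * y ^ 3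
      + D 1 0 * (x * z ^ 2) + D 1 1 * (x * y * z) + D 1 2 * (x * y ^ 2)
      + D 2 0 * (x ^ 2 * z) + D 2 1 * (x ^ 2 * y) + D 3 0 * x ^ 3 := ⟨_, fun _ _ _ => rfl⟩
  obtain ⟨P, hP⟩ : ∃ P : ℂ → ℂ → ℂ → ℂ, ∀ x y z, P x y z =
      p 0 0 * z ^ 3 + p 0 1 * (y * z ^ 2) + p 0 2 * (y ^ 2 * z) + p 0 3 * y ^ 3
      + p 1 0 * (x * z ^ 2) + p 1 1 * (x * y * z) + p 1 2 * (x * y ^ 2)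
      + p 2 0 * (x ^ 2 * z) + p 2 1 * (x ^ 2 * y) + p 3 0 * x ^ 3 := ⟨_, fun _ _ _ => rfl⟩
  obtain ⟨Q, hQ⟩ : ∃ Q : ℂ → ℂ → ℂ → ℂ, ∀ x y z, Q x y z =
      q 0 0 * z ^ 3 + q 0 1 * (y * z ^ 2) + q 0 2 * (y ^ 2 * z) + q 0 3 * y ^ 3
      + q 1 0 * (x * z ^ 2) + q 1 1 * (x * y * z) + q 1 2 * (x * y ^ 2)
      + q 2 0 * (x ^ 2 * z) + q 2 1 * (x ^ 2 * y) + q 3 0 * x ^ 3 := ⟨_, fun _ _ _ => rfl⟩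
  have hc' : ∀ x y z, eval ![x, y, z] c = z * R x y z := by
    intro x y z
    rw [hD, hR, d0, d1, d2, d3, d4]; ring
  have ha' : ∀ x y z, eval ![x, y, z] a = x * (P x y z + R x y z) := by
    intro x y z
    rw [hA, hR, hP, hp, a0, a1, a2, a3, a4]; ring
  have hb' : ∀ x y z, eval ![x, y, z] b = y * (Q x y z + R x y z) := by
    intro x y z
    rw [hB, hR, hQ, hq, b0, b1, b2, b3, b4]; ring

  -- tangency conditions, modulo the Euler field
  have L3 : ∀ x y z, x + y - z = 0 → x * P x y z + y * Q x y z = 0 := by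
    intro x y z h
    have := t3 x y z (by linear_combination h)
    rw [ha', hb', hc'] at this
    linear_combination this - R x y z * h
  have L4 : ∀ x y z, x - y + z = 0 → x * P x y z - y * Q x y z = 0 := by
    intro x y z h
    have := t4 x y z (by linear_combination h)
    rw [ha', hb', hc'] at this
    linear_combination this - R x y z * h
  have L5 : ∀ x y z, 2 * x - 2 * y + z = 0 → 2 * x * P x y z - 2 * y * Q x y z = 0 := by
    intro x y z h
    have := t5 x y z (by linear_combination h)
    rw [ha', hb', hc'] at this
    linear_combination this - R x y z * h
  have L6 : ∀ x y z, 2 * x - y - 2 * z = 0 → 2 * x * P x y z - y * Q x y z = 0 := by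
    intro x y z h
    have := t6 x y z (by linear_combination h)
    rw [ha', hb', hc'] at this
    linear_combination this - R x y z * h
  have L7 : ∀ x y z, 2 * x + y + z = 0 → 2 * x * P x y z + y * Q x y z = 0 := by
    intro x y z h
    have := t7 x y z (by linear_combination h)
    rw [ha', hb', hc'] at this
    linear_combination this - R x y z * h
  have L8 : ∀ x y z, 2 * x - y - z = 0 → 2 * x * P x y z - y * Q x y z = 0 := by
    intro x y z h
    have := t8 x y z (by linear_combination h)
    rw [ha', hb', hc'] at this
    linear_combination this - R x y z * h
  clear t0 t1 t2 t3 t4 t5 t6 t7 t8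
  -- `P` is divisible by `y`
  obtain ⟨p0, p1, p2, p3⟩ := cubic_zero (p 3 0) (p 2 0) (p 1 0) (p 0 0)
    (by have := L3 1 0 1 (by norm_num); rw [hP] at this; linear_combination this)
    (by have := L4 1 0 (-1) (by norm_num); rw [hP] at this; linear_combination this)
    (by have := L8 1 0 2 (by norm_num); rw [hP] at this; linear_combination this / 2)
    (by have := L7 1 0 (-2) (by norm_num); rw [hP] at this; linear_combination this / 2)
  -- `Q` is divisible by `x`
  obtain ⟨q0, q1, q2, q3⟩ := cubic_zero' (q 0 3) (q 0 2) (q 0 1) (q 0 0)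
    (by have := L3 0 1 1 (by norm_num); rw [hQ] at this; linear_combination this)
    (by have := L7 0 1 (-1) (by norm_num); rw [hQ] at this; linear_combination this)
    (by have := L5 0 1 2 (by norm_num); rw [hQ] at this; linear_combination -this / 2)
    (by have := L6 0 2 (-1) (by norm_num); rw [hQ] at this; linear_combination -this / 2)
  obtain ⟨P', hP'⟩ : ∃ P' : ℂ → ℂ → ℂ → ℂ, ∀ x y z, P' x y z =
      p 2 1 * x ^ 2 + p 1 2 * (x * y) + p 1 1 * (x * z) + p 0 3 * y ^ 2 + p 0 2 * (y * z)
      + p 0 1 * z ^ 2 := ⟨_, fun _ _ _ => rfl⟩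
  obtain ⟨Q', hQ'⟩ : ∃ Q' : ℂ → ℂ → ℂ → ℂ, ∀ x y z, Q' x y z =
      q 3 0 * x ^ 2 + q 2 1 * (x * y) + q 2 0 * (x * z) + q 1 2 * y ^ 2 + q 1 1 * (y * z)
      + q 1 0 * z ^ 2 := ⟨_, fun _ _ _ => rfl⟩
  have eP : ∀ x y z, P x y z = y * P' x y z := by
    intro x y z; rw [hP, hP', p0, p1, p2, p3]; ring
  have eQ : ∀ x y z, Q x y z = x * Q' x y z := by
    intro x y z; rw [hQ, hQ', q0, q1, q2, q3]; ring
  simp only [eP, eQ] at L3 L4 L5 L6 L7 L8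
  -- the nine intersection points
  have k1 : P' 1 3 4 = 0 ∧ Q' 1 3 4 = 0 := by
    have e := L3 1 3 4 (by norm_num)
    have e' := L5 1 3 4 (by norm_num)
    constructor <;> grind
  have k2 : P' 2 (-3) (-1) = 0 ∧ Q' 2 (-3) (-1) = 0 := by
    have e := L3 2 (-3) (-1) (by norm_num)
    have e' := L7 2 (-3) (-1) (by norm_num)
    constructor <;> grind
  have k3 : P' 2 1 3 = 0 ∧ Q' 2 1 3 = 0 := by
    have e := L3 2 1 3 (by norm_num)
    have e' := L8 2 1 3 (by norm_num)
    constructor <;> grind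
  have k4 : P' 3 4 1 = 0 ∧ Q' 3 4 1 = 0 := by
    have e := L4 3 4 1 (by norm_num)
    have e' := L6 3 4 1 (by norm_num)
    constructor <;> grind
  have k5 : P' 2 (-1) (-3) = 0 ∧ Q' 2 (-1) (-3) = 0 := by
    have e := L4 2 (-1) (-3) (by norm_num)
    have e' := L7 2 (-1) (-3) (by norm_num)
    constructor <;> grind
  have k6 : P' 2 3 1 = 0 ∧ Q' 2 3 1 = 0 := by
    have e := L4 2 3 1 (by norm_num)
    have e' := L8 2 3 1 (by norm_num)
    constructor <;> grind
  have k7 : P' 5 6 2 = 0 ∧ Q' 5 6 2 = 0 := by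
    have e := L5 5 6 2 (by norm_num)
    have e' := L6 5 6 2 (by norm_num)
    constructor <;> grind
  have k8 : P' 3 4 2 = 0 ∧ Q' 3 4 2 = 0 := by
    have e := L5 3 4 2 (by norm_num)
    have e' := L8 3 4 2 (by norm_num)
    constructor <;> grind
  have k9 : P' 1 (-6) 4 = 0 ∧ Q' 1 (-6) 4 = 0 := by
    have e := L6 1 (-6) 4 (by norm_num)
    have e' := L7 1 (-6) 4 (by norm_num)
    constructor <;> grind
  have zP := conic_zero _ _ _ _ _ _ P' hP' k1.1 k2.1 k3.1 k4.1 k5.1 k6.1 k7.1 k8.1 k9.1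
  have zQ := conic_zero _ _ _ _ _ _ Q' hQ' k1.2 k2.2 k3.2 k4.2 k5.2 k6.2 k7.2 k8.2 k9.2
  have hv : ∀ v : Fin 3 → ℂ, v = ![v 0, v 1, v 2] := by
    intro v; ext i; fin_cases i <;> rfl
  constructor
  · apply MvPolynomial.funext
    intro v
    rw [hv v, map_mul, map_mul, ha', hc', eP, zP]
    simp; ring
  · apply MvPolynomial.funext
    intro v
    rw [hv v, map_mul, map_mul, hb', hc', eQ, zQ]
    simp; ring

lemma deg_four_zero (a b c : MvPolynomial (Fin 3) ℂ)
    (ha : a.IsHomogeneous 4) (hb : b.IsHomogeneous 4) (hc : c.IsHomogeneous 4)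
    (hs : a * pderiv 0 fZ + b * pderiv 1 fZ + c * pderiv 2 fZ = 0) :
    a = 0 ∧ b = 0 ∧ c = 0 := by
  obtain ⟨h1, h2⟩ := deg_four a b c ha hb hc hs
  have hE := fZ_hom.sum_X_mul_pderiv
  rw [Fin.sum_univ_three, nsmul_eq_mul] at hE
  have h9 : c * ((9 : ℕ) * fZ) = 0 := by
    linear_combination X 2 * hs - pderiv 0 fZ * h1 - pderiv 1 fZ * h2 - c * hE
  have hc0 : c = 0 := by
    have : ((9 : ℕ) : MvPolynomial (Fin 3) ℂ) ≠ 0 := by norm_num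
    exact (mul_eq_zero.mp h9).resolve_right (mul_ne_zero this fZ_ne)
  have hX : (X 2 : MvPolynomial (Fin 3) ℂ) ≠ 0 := X_ne_zero 2
  rw [hc0, mul_zero] at h1 h2
  exact ⟨(mul_eq_zero.mp h1).resolve_left hX, (mul_eq_zero.mp h2).resolve_left hX, hc0⟩

lemma hom_mul (k : ℂ) (i j l n : ℕ) (h : i + j + l = n) :
    (C k * (X 0 ^ i * X 1 ^ j * X 2 ^ l) : MvPolynomial (Fin 3) ℂ).IsHomogeneous n := by
  have hX : ∀ (s : Fin 3) (m : ℕ), (X s ^ m : MvPolynomial (Fin 3) ℂ).IsHomogeneous m :=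
    fun s m => by simpa using (isHomogeneous_X ℂ s).pow m
  have := (isHomogeneous_C (Fin 3) k).mul (((hX 0 i).mul (hX 1 j)).mul (hX 2 l))
  rwa [zero_add, h] at this

end Ziegler

set_option maxHeartbeats 4000000 in
/-- mdr(f_Z) = 5: there is a nonzero Jacobian syzygy of degree 5 and none of degree ≤ 4. -/
theorem ziegler_mdr_five :
    (∃ a b c : MvPolynomial (Fin 3) ℂ,
      a.IsHomogeneous 5 ∧ b.IsHomogeneous 5 ∧ c.IsHomogeneous 5 ∧
      ¬ (a = 0 ∧ b = 0 ∧ c = 0) ∧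
      a * pderiv 0 fZ + b * pderiv 1 fZ + c * pderiv 2 fZ = 0) ∧
    (∀ r : ℕ, r ≤ 4 → ∀ a b c : MvPolynomial (Fin 3) ℂ,
      a.IsHomogeneous r → b.IsHomogeneous r → c.IsHomogeneous r →
      a * pderiv 0 fZ + b * pderiv 1 fZ + c * pderiv 2 fZ = 0 →
      a = 0 ∧ b = 0 ∧ c = 0) := by
  refine ⟨⟨C (-40) * (X 0 ^ 5 * X 1 ^ 0 * X 2 ^ 0)
      + C (72) * (X 0 ^ 4 * X 1 ^ 1 * X 2 ^ 0)
      + C (56) * (X 0 ^ 4 * X 1 ^ 0 * X 2 ^ 1)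
      + C (16) * (X 0 ^ 3 * X 1 ^ 2 * X 2 ^ 0)
      + C (-240) * (X 0 ^ 3 * X 1 ^ 1 * X 2 ^ 1)
      + C (216) * (X 0 ^ 3 * X 1 ^ 0 * X 2 ^ 2)
      + C (-30) * (X 0 ^ 2 * X 1 ^ 3 * X 2 ^ 0)
      + C (18) * (X 0 ^ 2 * X 1 ^ 2 * X 2 ^ 1)
      + C (-246) * (X 0 ^ 2 * X 1 ^ 1 * X 2 ^ 2)
      + C (10) * (X 0 ^ 2 * X 1 ^ 0 * X 2 ^ 3)
      + C (72) * (X 0 ^ 1 * X 1 ^ 3 * X 2 ^ 1)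
      + C (80) * (X 0 ^ 1 * X 1 ^ 2 * X 2 ^ 2)
      + C (72) * (X 0 ^ 1 * X 1 ^ 1 * X 2 ^ 3)
      + C (-80) * (X 0 ^ 1 * X 1 ^ 0 * X 2 ^ 4),
    C (-4) * (X 0 ^ 4 * X 1 ^ 1 * X 2 ^ 0)
      + C (72) * (X 0 ^ 3 * X 1 ^ 2 * X 2 ^ 0)
      + C (-286) * (X 0 ^ 3 * X 1 ^ 1 * X 2 ^ 1)
      + C (-29) * (X 0 ^ 2 * X 1 ^ 3 * X 2 ^ 0)
      + C (165) * (X 0 ^ 2 * X 1 ^ 2 * X 2 ^ 1)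
      + C (-108) * (X 0 ^ 2 * X 1 ^ 1 * X 2 ^ 2)
      + C (-30) * (X 0 ^ 1 * X 1 ^ 4 * X 2 ^ 0)
      + C (9) * (X 0 ^ 1 * X 1 ^ 3 * X 2 ^ 1)
      + C (240) * (X 0 ^ 1 * X 1 ^ 2 * X 2 ^ 2)
      + C (1) * (X 0 ^ 1 * X 1 ^ 1 * X 2 ^ 3)
      + C (9) * (X 0 ^ 0 * X 1 ^ 5 * X 2 ^ 0)
      + C (18) * (X 0 ^ 0 * X 1 ^ 4 * X 2 ^ 1)
      + C (-82) * (X 0 ^ 0 * X 1 ^ 3 * X 2 ^ 2)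
      + C (-90) * (X 0 ^ 0 * X 1 ^ 2 * X 2 ^ 3)
      + C (73) * (X 0 ^ 0 * X 1 ^ 1 * X 2 ^ 4),
    C (284) * (X 0 ^ 4 * X 1 ^ 0 * X 2 ^ 1)
      + C (-522) * (X 0 ^ 3 * X 1 ^ 1 * X 2 ^ 1)
      + C (56) * (X 0 ^ 3 * X 1 ^ 0 * X 2 ^ 2)
      + C (52) * (X 0 ^ 2 * X 1 ^ 2 * X 2 ^ 1)
      + C (165) * (X 0 ^ 2 * X 1 ^ 1 * X 2 ^ 2)
      + C (-189) * (X 0 ^ 2 * X 1 ^ 0 * X 2 ^ 3)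
      + C (213) * (X 0 ^ 1 * X 1 ^ 3 * X 2 ^ 1)
      + C (-3) * (X 0 ^ 1 * X 1 ^ 1 * X 2 ^ 3)
      + C (10) * (X 0 ^ 1 * X 1 ^ 0 * X 2 ^ 4)
      + C (-63) * (X 0 ^ 0 * X 1 ^ 4 * X 2 ^ 1)
      + C (-90) * (X 0 ^ 0 * X 1 ^ 3 * X 2 ^ 2)
      + C (62) * (X 0 ^ 0 * X 1 ^ 2 * X 2 ^ 3)
      + C (18) * (X 0 ^ 0 * X 1 ^ 1 * X 2 ^ 4)
      + C (1) * (X 0 ^ 0 * X 1 ^ 0 * X 2 ^ 5), ?_, ?_, ?_, ?_, ?_⟩, ?_⟩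
  · repeat' apply IsHomogeneous.add
    all_goals exact Ziegler.hom_mul _ _ _ _ _ rfl
  · repeat' apply IsHomogeneous.add
    all_goals exact Ziegler.hom_mul _ _ _ _ _ rfl
  · repeat' apply IsHomogeneous.add
    all_goals exact Ziegler.hom_mul _ _ _ _ _ rfl
  · rintro ⟨-, -, h⟩
    have := congrArg (eval ![0, 0, 1]) h
    simp at this
  · apply MvPolynomial.funext
    intro v
    have e0 := Ziegler.eval_pderiv v 0 _ rfl
    have e1 := Ziegler.eval_pderiv v 1 _ rfl
    have e2 := Ziegler.eval_pderiv v 2 _ rfl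
    simp only [Pi.single_apply, Fin.reduceEq, if_true, if_false] at e0 e1 e2
    simp only [map_add, map_mul, map_zero, e0, e1, e2, map_pow, eval_C, eval_X]
    clear e0 e1 e2
    generalize v 0 = x
    generalize v 1 = y
    generalize v 2 = z
    ring
  · intro r hr a b c ha hb hc hs
    have hX := (isHomogeneous_X ℂ (0 : Fin 3)).pow (4 - r)
    have e : 1 * (4 - r) + r = 4 := by omega
    have hne : (X 0 ^ (4 - r) : MvPolynomial (Fin 3) ℂ) ≠ 0 := pow_ne_zero _ (X_ne_zero 0)
    have := Ziegler.deg_four_zero (X 0 ^ (4 - r) * a) (X 0 ^ (4 - r) * b) (X 0 ^ (4 - r) * c)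
      (e ▸ hX.mul ha) (e ▸ hX.mul hb) (e ▸ hX.mul hc)
      (by linear_combination X 0 ^ (4 - r) * hs)
    simpa [hne] using this
end

section
/- Let f' = xy(4x-5y-5z)(x-y+z)(16x+13y-20z)(x+3y-3z)(3x+2y+3z)(x+5y+5z)(7x-4y-z) in ℂ[x,y,z]. Then there is no nonzero triple (a,b,c) of homogeneous polynomials of degree 5 with a·f'_x + b·f'_y + c·f'_z = 0; i.e. mdr(f') ≥ 6. -/
open MvPolynomial

/-- The arrangement 𝒜' of Dimca–Hanumanthu with the same combinatorics as 𝒜_D. -/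
noncomputable def fA' : MvPolynomial (Fin 3) ℂ :=
  (X 0) * (X 1) * (4 • X 0 - 5 • X 1 - 5 • X 2) * (X 0 - X 1 + X 2) *
  (16 • X 0 + 13 • X 1 - 20 • X 2) * (X 0 + 3 • X 1 - 3 • X 2) *
  (3 • X 0 + 2 • X 1 + 3 • X 2) * (X 0 + 5 • X 1 + 5 • X 2) *
  (7 • X 0 - 4 • X 1 - X 2)

/-- Sample points. -/
def syzPts : List (ℤ × ℤ × ℤ) := [
  (2, 7, 3), (8, 2, 7), (1, 8, 2), (4, 3, 1), (2, 5, 4), (7, 3, 4), (6, 7, 2), (6, 9, 7), (9, 3,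
  2), (5, 8, 2), (3, 6, 8), (2, 2, 7), (7, 2, 5), (1, 4, 3), (5, 9, 4), (6, 5, 3), (8, 7, 2),
  (1, 1, 3), (9, 8, 2), (6, 6, 7), (4, 4, 3), (3, 9, 1), (8, 5, 3), (2, 3, 6), (5, 1, 2), (1, 4,
  5), (1, 3, 5), (1, 3, 9), (9, 2, 9), (7, 8, 6), (1, 2, 1), (5, 8, 4), (9, 7, 1), (3, 7, 6),
  (6, 4, 1), (7, 7, 1), (3, 8, 3), (6, 5, 8), (7, 9, 9), (3, 9, 5), (5, 4, 3), (3, 9, 3), (9, 6,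
  1), (3, 7, 9), (6, 8, 3), (4, 6, 9), (6, 3, 4), (8, 1, 3), (9, 2, 1), (2, 3, 4), (3, 4, 2),
  (8, 9, 6), (4, 7, 7), (2, 5, 7), (5, 2, 8), (9, 9, 9), (7, 3, 9), (7, 4, 7), (9, 5, 3), (3, 4,
  6), (4, 8, 5), (4, 6, 3), (8, 4, 8)]

/-- Exponents of degree 5. -/
def syzE : List (ℕ × ℕ × ℕ) := [
  (0, 0, 5), (0, 1, 4), (0, 2, 3), (0, 3, 2), (0, 4, 1), (0, 5, 0), (1, 0, 4), (1, 1, 3), (1, 2,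
  2), (1, 3, 1), (1, 4, 0), (2, 0, 3), (2, 1, 2), (2, 2, 1), (2, 3, 0), (3, 0, 2), (3, 1, 1),
  (3, 2, 0), (4, 0, 1), (4, 1, 0), (5, 0, 0)]

/-- Columns of the evaluation matrix mod 997. -/
def syzT : List (List ℕ) := [
  [408, 97, 766, 19, 151, 374, 944, 448, 613, 625, 466, 43, 174, 249, 368, 923, 463, 952, 668, 294, 313, 651, 914, 635, 143, 280, 127, 541, 785, 437, 383, 666, 698, 20, 896, 883, 132, 284, 953, 838, 784, 286, 280, 661, 945, 764, 943, 496, 582, 986, 986, 592, 576, 180, 676, 216, 204, 984, 792, 767, 950, 692, 543],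
  [952, 455, 73, 57, 438, 779, 313, 576, 421, 506, 848, 582, 269, 332, 828, 209, 125, 982, 678, 252, 85, 874, 194, 816, 570, 224, 475, 845, 396, 915, 766, 335, 898, 688, 593, 199, 352, 676, 953, 312, 713, 858, 683, 71, 526, 177, 458, 830, 167, 241, 975, 888, 576, 271, 169, 216, 68, 135, 323, 179, 523, 387, 770],
  [892, 130, 292, 171, 49, 335, 597, 883, 133, 30, 636, 736, 307, 775, 866, 16, 936, 992, 718, 216, 778, 887, 988, 408, 285, 578, 285, 614, 88, 223, 535, 670, 304, 138, 378, 396, 274, 921, 953, 761, 286, 580, 110, 166, 738, 118, 842, 609, 334, 430, 953, 335, 576, 336, 790, 216, 355, 362, 206, 784, 438, 774, 385],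
  [752, 322, 171, 513, 809, 2, 594, 708, 698, 120, 477, 780, 721, 701, 453, 359, 285, 663, 878, 470, 705, 7, 982, 204, 641, 263, 171, 537, 795, 962, 73, 343, 134, 161, 515, 778, 66, 451, 953, 971, 49, 743, 660, 683, 971, 411, 133, 203, 668, 821, 909, 4, 576, 240, 696, 216, 783, 919, 11, 855, 302, 551, 691],
  [93, 92, 684, 542, 762, 500, 85, 483, 50, 480, 607, 935, 89, 270, 770, 266, 499, 221, 521, 118, 940, 63, 972, 102, 819, 11, 302, 179, 509, 618, 146, 686, 938, 354, 66, 461, 176, 905, 953, 352, 730, 235, 969, 642, 263, 274, 349, 400, 339, 865, 821, 6, 576, 29, 174, 216, 261, 810, 683, 570, 882, 105, 844],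
  [217, 596, 742, 629, 454, 375, 796, 621, 75, 923, 206, 552, 235, 360, 237, 111, 251, 406, 90, 386, 921, 567, 623, 51, 908, 607, 580, 392, 667, 824, 292, 375, 584, 413, 264, 236, 137, 441, 953, 833, 641, 705, 829, 167, 369, 515, 511, 798, 678, 898, 645, 9, 576, 448, 542, 216, 87, 178, 806, 380, 813, 210, 422],
  [272, 823, 383, 76, 574, 156, 838, 384, 266, 67, 424, 582, 443, 83, 460, 849, 855, 982, 15, 252, 85, 956, 111, 544, 856, 56, 823, 614, 785, 676, 383, 334, 300, 10, 391, 199, 132, 213, 852, 104, 642, 286, 526, 885, 893, 118, 916, 658, 253, 493, 482, 457, 614, 906, 921, 216, 491, 984, 382, 882, 760, 258, 543],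
  [967, 520, 535, 228, 219, 117, 939, 921, 399, 268, 318, 736, 576, 443, 38, 418, 500, 992, 60, 216, 778, 628, 185, 272, 428, 643, 95, 537, 396, 569, 766, 668, 106, 344, 567, 396, 352, 507, 852, 586, 856, 858, 165, 356, 55, 411, 687, 884, 506, 619, 964, 187, 614, 932, 978, 216, 496, 135, 969, 588, 219, 516, 770],
  [927, 291, 146, 684, 523, 337, 794, 472, 100, 75, 737, 780, 31, 923, 584, 32, 753, 663, 240, 470, 705, 667, 973, 136, 214, 315, 57, 179, 88, 94, 535, 339, 742, 69, 274, 778, 274, 940, 852, 656, 809, 580, 990, 720, 479, 274, 266, 627, 15, 215, 931, 779, 614, 96, 743, 216, 830, 362, 618, 392, 151, 35, 385],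
  [169, 368, 584, 58, 903, 502, 785, 322, 150, 300, 802, 935, 810, 566, 317, 718, 143, 221, 960, 118, 940, 21, 957, 68, 107, 252, 433, 392, 795, 790, 73, 678, 209, 579, 99, 461, 66, 89, 852, 782, 414, 743, 955, 560, 945, 515, 698, 209, 30, 909, 865, 670, 614, 211, 435, 216, 609, 919, 33, 926, 441, 70, 691],
  [62, 390, 342, 174, 381, 875, 255, 414, 225, 203, 103, 552, 324, 90, 464, 532, 2, 406, 849, 386, 921, 189, 598, 34, 552, 401, 858, 463, 509, 721, 146, 359, 466, 177, 396, 236, 176, 928, 852, 610, 552, 235, 745, 214, 526, 11, 25, 402, 60, 931, 733, 8, 614, 578, 358, 216, 203, 810, 55, 285, 905, 140, 844],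
  [846, 86, 690, 304, 287, 273, 520, 614, 200, 666, 159, 736, 22, 360, 575, 701, 429, 992, 566, 216, 778, 874, 296, 846, 146, 410, 364, 179, 785, 124, 383, 916, 706, 5, 352, 396, 132, 409, 995, 860, 73, 286, 746, 295, 789, 274, 377, 93, 283, 745, 723, 277, 66, 971, 451, 216, 825, 984, 149, 441, 608, 344, 543],
  [977, 167, 766, 912, 608, 454, 823, 647, 300, 670, 867, 780, 607, 480, 546, 836, 6, 663, 270, 470, 705, 887, 161, 423, 73, 328, 19, 392, 396, 830, 766, 835, 954, 172, 411, 778, 352, 131, 995, 551, 762, 858, 488, 451, 110, 515, 532, 31, 566, 808, 449, 914, 66, 836, 362, 216, 275, 135, 913, 294, 574, 688, 770],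
  [618, 475, 73, 742, 760, 839, 388, 547, 450, 686, 401, 935, 841, 640, 730, 64, 21, 221, 83, 118, 940, 7, 933, 710, 535, 63, 809, 463, 88, 442, 535, 673, 696, 533, 647, 461, 274, 705, 995, 593, 19, 580, 934, 240, 958, 11, 399, 675, 135, 606, 898, 374, 66, 882, 589, 216, 424, 362, 857, 196, 719, 379, 385],
  [445, 563, 292, 232, 950, 380, 361, 276, 675, 750, 550, 552, 137, 521, 147, 439, 572, 406, 332, 386, 921, 63, 558, 355, 766, 848, 286, 819, 795, 257, 73, 349, 884, 788, 594, 236, 66, 316, 995, 868, 690, 743, 619, 519, 893, 672, 50, 225, 270, 953, 799, 561, 66, 630, 895, 216, 806, 919, 99, 463, 951, 758, 691],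
  [564, 668, 345, 219, 642, 727, 563, 99, 900, 668, 932, 780, 629, 120, 968, 405, 719, 663, 553, 470, 705, 628, 457, 282, 365, 82, 671, 463, 785, 477, 383, 148, 372, 501, 118, 778, 132, 556, 220, 516, 454, 286, 732, 763, 581, 11, 67, 248, 553, 871, 586, 37, 465, 135, 905, 216, 974, 984, 447, 719, 287, 791, 543],
  [319, 903, 383, 657, 304, 296, 475, 697, 353, 678, 699, 935, 451, 160, 184, 675, 24, 221, 218, 118, 940, 667, 97, 141, 681, 265, 602, 819, 396, 636, 766, 296, 610, 86, 472, 461, 352, 846, 220, 530, 273, 858, 404, 815, 220, 672, 798, 415, 109, 404, 175, 554, 465, 951, 974, 216, 657, 135, 745, 147, 858, 585, 770],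
  [412, 258, 535, 974, 380, 222, 167, 184, 31, 718, 275, 552, 978, 878, 414, 128, 84, 406, 872, 386, 921, 21, 494, 569, 839, 212, 760, 273, 88, 848, 535, 592, 282, 765, 891, 236, 274, 778, 220, 954, 364, 580, 430, 80, 919, 448, 100, 803, 218, 303, 350, 831, 465, 252, 742, 216, 219, 362, 577, 98, 974, 173, 385],
  [376, 621, 671, 876, 321, 26, 692, 797, 62, 673, 848, 935, 83, 40, 213, 810, 882, 221, 993, 118, 940, 887, 554, 94, 414, 814, 533, 273, 785, 58, 383, 185, 357, 749, 708, 461, 132, 417, 725, 509, 92, 286, 606, 919, 165, 448, 599, 329, 989, 934, 879, 714, 693, 181, 441, 216, 536, 984, 344, 858, 429, 390, 543],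
  [545, 35, 690, 634, 152, 518, 428, 455, 93, 698, 636, 552, 432, 718, 230, 353, 96, 406, 981, 386, 921, 7, 591, 47, 207, 53, 918, 91, 396, 742, 766, 370, 505, 43, 838, 236, 352, 136, 725, 318, 455, 858, 645, 604, 440, 631, 200, 442, 981, 202, 761, 74, 693, 699, 858, 216, 511, 135, 241, 572, 487, 780, 770],
  [583, 140, 834, 513, 659, 544, 82, 968, 279, 187, 318, 552, 515, 678, 17, 623, 537, 406, 979, 386, 921, 667, 148, 696, 38, 761, 306, 695, 785, 400, 383, 979, 222, 873, 260, 236, 132, 562, 10, 106, 818, 286, 469, 971, 330, 753, 400, 545, 925, 467, 820, 952, 396, 479, 151, 216, 860, 984, 35, 429, 742, 520, 543],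
  [389, 950, 837, 844, 273, 646, 53, 868, 249, 548, 203, 151, 616, 748, 629, 643, 324, 453, 661, 875, 488, 774, 33, 680, 571, 761, 568, 838, 146, 538, 614, 305, 705, 195, 833, 349, 717, 568, 146, 806, 800, 822, 405, 493, 614, 911, 71, 80, 983, 376, 612, 499, 458, 814, 404, 844, 480, 175, 654, 116, 401, 425, 10],
  [243, 129, 357, 538, 92, 983, 684, 119, 872, 198, 900, 328, 47, 665, 169, 407, 137, 151, 650, 750, 983, 984, 55, 340, 784, 210, 939, 944, 254, 385, 231, 610, 947, 726, 341, 449, 915, 355, 146, 55, 402, 472, 436, 605, 308, 275, 801, 359, 969, 282, 227, 250, 458, 439, 101, 844, 160, 100, 93, 742, 841, 850, 5],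
  [567, 749, 431, 617, 115, 488, 400, 153, 311, 792, 675, 521, 617, 222, 131, 346, 978, 715, 606, 358, 646, 880, 424, 170, 392, 168, 364, 647, 278, 181, 462, 223, 647, 847, 367, 152, 446, 845, 146, 99, 536, 419, 622, 249, 489, 848, 850, 452, 941, 710, 454, 375, 458, 456, 773, 844, 718, 342, 155, 827, 548, 703, 501],
  [326, 214, 727, 854, 393, 366, 403, 624, 965, 177, 257, 861, 845, 296, 544, 909, 432, 903, 430, 22, 529, 941, 42, 85, 196, 932, 19, 548, 948, 906, 924, 446, 541, 822, 471, 67, 857, 902, 146, 577, 50, 260, 741, 526, 307, 233, 139, 483, 885, 34, 908, 64, 458, 753, 941, 844, 904, 53, 923, 219, 478, 409, 749],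
  [96, 346, 914, 568, 242, 773, 912, 375, 949, 708, 442, 246, 338, 727, 227, 518, 515, 301, 723, 731, 373, 493, 70, 541, 98, 945, 809, 515, 543, 211, 851, 892, 796, 959, 887, 469, 956, 813, 146, 241, 399, 780, 458, 963, 154, 820, 852, 161, 773, 524, 819, 96, 458, 253, 983, 844, 966, 600, 209, 146, 366, 818, 873],
  [224, 811, 665, 707, 801, 829, 201, 767, 925, 838, 830, 640, 534, 637, 760, 531, 307, 765, 898, 769, 165, 449, 449, 769, 49, 756, 286, 504, 453, 946, 705, 787, 587, 288, 557, 292, 223, 882, 146, 35, 532, 346, 754, 749, 743, 879, 639, 386, 549, 393, 641, 144, 458, 608, 495, 844, 322, 58, 16, 762, 785, 639, 935],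
  [924, 516, 917, 385, 635, 632, 159, 744, 622, 373, 450, 328, 663, 914, 537, 289, 299, 151, 482, 750, 983, 328, 88, 559, 929, 551, 313, 647, 146, 960, 614, 132, 363, 596, 13, 449, 717, 426, 889, 683, 4, 822, 654, 829, 231, 848, 605, 878, 871, 188, 918, 333, 689, 375, 751, 844, 41, 175, 965, 58, 919, 899, 10],
  [162, 5, 677, 158, 46, 474, 58, 102, 933, 495, 836, 521, 664, 554, 959, 814, 548, 715, 931, 358, 646, 958, 479, 778, 963, 42, 786, 548, 254, 283, 231, 264, 547, 363, 52, 152, 915, 17, 889, 33, 670, 472, 933, 534, 616, 233, 703, 625, 745, 141, 839, 1, 689, 980, 437, 844, 346, 100, 279, 371, 274, 801, 5],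
  [378, 856, 714, 474, 556, 854, 203, 416, 901, 983, 627, 861, 465, 74, 413, 692, 921, 903, 733, 22, 529, 646, 466, 389, 980, 233, 671, 515, 278, 45, 462, 528, 838, 922, 208, 67, 446, 883, 889, 857, 561, 419, 613, 83, 978, 820, 278, 873, 493, 355, 681, 500, 689, 700, 857, 844, 780, 342, 465, 912, 239, 605, 501],
  [882, 387, 862, 425, 695, 142, 212, 250, 853, 941, 221, 246, 186, 431, 680, 821, 731, 301, 938, 731, 373, 829, 112, 693, 490, 984, 602, 504, 948, 60, 924, 59, 881, 411, 832, 469, 857, 178, 889, 745, 748, 260, 687, 840, 614, 879, 707, 291, 986, 17, 365, 750, 689, 500, 962, 844, 260, 53, 775, 608, 183, 213, 749],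
  [64, 253, 457, 278, 121, 605, 742, 179, 781, 773, 415, 640, 872, 907, 533, 39, 66, 765, 761, 769, 165, 482, 519, 845, 245, 189, 760, 168, 543, 80, 851, 118, 185, 978, 337, 292, 956, 859, 889, 344, 665, 780, 134, 321, 308, 586, 281, 97, 975, 262, 730, 128, 689, 642, 739, 844, 419, 600, 627, 73, 891, 426, 873],
  [616, 20, 957, 543, 816, 109, 477, 68, 805, 434, 418, 521, 330, 637, 422, 578, 199, 715, 175, 358, 646, 984, 567, 851, 827, 509, 262, 515, 146, 123, 614, 165, 276, 298, 78, 152, 717, 818, 913, 11, 339, 822, 901, 941, 462, 820, 409, 15, 860, 94, 380, 444, 821, 392, 594, 844, 475, 175, 901, 29, 137, 534, 10],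
  [108, 433, 837, 632, 23, 331, 174, 942, 709, 739, 812, 861, 132, 517, 451, 631, 198, 903, 700, 22, 529, 880, 945, 924, 912, 806, 556, 504, 254, 164, 231, 330, 935, 680, 312, 67, 915, 262, 913, 618, 452, 472, 421, 178, 235, 879, 556, 5, 723, 569, 760, 666, 821, 280, 647, 844, 823, 100, 837, 684, 618, 71, 5],
  [252, 551, 357, 899, 278, 996, 609, 499, 565, 962, 609, 246, 651, 357, 267, 387, 693, 301, 806, 731, 373, 941, 578, 462, 456, 246, 533, 168, 278, 551, 462, 660, 563, 461, 251, 469, 446, 413, 913, 913, 935, 419, 532, 360, 959, 586, 417, 334, 449, 676, 523, 2, 821, 200, 411, 844, 939, 342, 398, 456, 590, 142, 501],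
  [588, 15, 431, 703, 846, 747, 636, 784, 349, 857, 706, 640, 61, 476, 850, 645, 930, 765, 233, 769, 165, 493, 631, 231, 228, 795, 918, 56, 948, 70, 924, 323, 950, 704, 7, 292, 857, 632, 913, 447, 582, 260, 201, 280, 231, 723, 562, 776, 898, 507, 49, 3, 821, 855, 352, 844, 313, 53, 331, 304, 944, 284, 749],
  [743, 735, 977, 178, 408, 440, 434, 628, 133, 88, 406, 861, 462, 877, 29, 159, 796, 903, 289, 22, 529, 958, 515, 616, 572, 700, 850, 168, 146, 642, 614, 954, 490, 149, 468, 67, 717, 115, 267, 206, 565, 822, 133, 646, 924, 586, 115, 40, 761, 47, 570, 592, 754, 112, 122, 844, 591, 175, 709, 513, 309, 712, 10],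
  [72, 210, 917, 534, 510, 330, 522, 665, 698, 352, 803, 246, 783, 837, 813, 265, 792, 301, 159, 731, 373, 646, 526, 308, 286, 560, 510, 56, 254, 856, 231, 911, 439, 340, 875, 469, 915, 695, 267, 969, 421, 472, 798, 724, 470, 723, 834, 678, 525, 783, 143, 888, 754, 80, 529, 844, 197, 100, 517, 342, 295, 427, 5],
  [168, 60, 677, 605, 139, 746, 830, 855, 50, 411, 353, 640, 712, 119, 583, 774, 778, 765, 636, 769, 165, 829, 212, 154, 143, 448, 306, 351, 278, 809, 462, 825, 82, 729, 509, 292, 446, 559, 267, 149, 229, 419, 800, 120, 921, 482, 127, 226, 53, 338, 286, 335, 754, 342, 880, 844, 398, 342, 197, 228, 472, 854, 501],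
  [163, 840, 987, 712, 204, 770, 305, 111, 100, 220, 900, 246, 248, 957, 784, 318, 193, 301, 802, 731, 373, 880, 44, 870, 433, 140, 170, 351, 146, 749, 614, 694, 422, 573, 814, 469, 717, 834, 540, 323, 277, 822, 200, 880, 851, 482, 671, 439, 867, 522, 855, 457, 146, 32, 824, 844, 792, 175, 133, 755, 646, 617, 10],
  [48, 240, 957, 142, 255, 79, 569, 570, 150, 880, 675, 640, 498, 279, 767, 530, 177, 765, 217, 769, 165, 941, 738, 435, 715, 112, 102, 117, 254, 334, 231, 391, 960, 170, 265, 292, 915, 272, 540, 382, 37, 472, 203, 906, 940, 986, 254, 811, 737, 890, 713, 187, 146, 735, 206, 844, 264, 100, 554, 171, 236, 237, 5],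
  [441, 960, 992, 854, 102, 849, 915, 380, 450, 550, 836, 640, 746, 319, 980, 636, 772, 765, 618, 769, 165, 646, 782, 290, 584, 28, 34, 39, 146, 43, 614, 369, 807, 785, 896, 292, 717, 127, 420, 792, 794, 822, 803, 958, 705, 325, 508, 506, 824, 261, 784, 277, 938, 294, 515, 844, 616, 175, 399, 876, 118, 158, 10],
  [203, 61, 242, 960, 795, 632, 153, 371, 514, 724, 752, 42, 558, 249, 368, 542, 138, 861, 682, 940, 281, 156, 381, 430, 861, 20, 639, 932, 846, 635, 383, 831, 78, 522, 357, 564, 591, 156, 26, 161, 327, 457, 878, 515, 453, 725, 660, 988, 663, 847, 160, 427, 170, 821, 719, 262, 826, 911, 150, 545, 410, 763, 690],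
  [806, 872, 968, 886, 246, 474, 37, 477, 771, 902, 564, 12, 622, 332, 828, 571, 483, 287, 734, 236, 707, 407, 635, 215, 929, 16, 184, 643, 188, 182, 766, 665, 546, 609, 431, 957, 579, 596, 26, 888, 436, 374, 283, 179, 211, 151, 495, 994, 329, 386, 320, 142, 170, 444, 429, 262, 940, 663, 250, 31, 656, 529, 345],
  [219, 534, 881, 664, 806, 854, 628, 186, 658, 617, 423, 858, 847, 775, 866, 287, 195, 428, 942, 772, 278, 672, 726, 606, 963, 611, 908, 879, 928, 575, 535, 333, 831, 212, 727, 717, 547, 871, 26, 402, 249, 125, 701, 250, 895, 433, 122, 996, 658, 788, 640, 213, 170, 602, 855, 262, 978, 94, 749, 353, 252, 61, 671],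
  [511, 295, 533, 995, 509, 142, 204, 524, 987, 474, 68, 530, 937, 701, 453, 146, 184, 475, 777, 92, 703, 66, 213, 303, 980, 90, 146, 293, 317, 102, 73, 666, 832, 912, 914, 34, 794, 669, 26, 923, 332, 375, 218, 416, 725, 621, 590, 332, 319, 591, 283, 818, 170, 430, 463, 262, 326, 481, 916, 900, 802, 122, 834],
  [860, 654, 138, 991, 387, 605, 714, 104, 982, 899, 51, 9, 973, 270, 770, 908, 644, 823, 117, 791, 605, 594, 355, 650, 490, 72, 287, 430, 292, 136, 146, 335, 839, 67, 665, 238, 788, 792, 26, 465, 775, 128, 311, 102, 604, 414, 941, 443, 638, 194, 566, 230, 170, 592, 365, 262, 441, 987, 862, 600, 685, 244, 417],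
  [345, 899, 552, 979, 733, 703, 505, 561, 476, 605, 786, 145, 788, 360, 237, 184, 260, 939, 468, 678, 142, 361, 924, 325, 245, 257, 571, 808, 508, 846, 292, 670, 888, 909, 666, 669, 772, 495, 26, 837, 701, 384, 869, 744, 946, 276, 955, 480, 279, 644, 135, 345, 170, 138, 839, 262, 147, 564, 772, 400, 99, 488, 707],
  [800, 497, 121, 849, 896, 109, 459, 318, 319, 813, 282, 12, 183, 83, 460, 87, 552, 287, 78, 236, 707, 468, 19, 808, 657, 4, 726, 879, 846, 907, 383, 291, 702, 261, 148, 957, 591, 117, 131, 296, 545, 457, 923, 504, 906, 433, 990, 973, 982, 922, 240, 237, 382, 377, 574, 262, 864, 911, 450, 771, 328, 685, 690],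
  [205, 142, 484, 553, 123, 331, 111, 124, 977, 261, 710, 858, 472, 443, 38, 145, 935, 428, 312, 772, 278, 224, 364, 404, 827, 402, 635, 293, 188, 877, 766, 582, 926, 803, 592, 717, 579, 447, 131, 134, 62, 374, 553, 392, 422, 621, 244, 989, 967, 193, 480, 854, 382, 839, 642, 262, 288, 663, 750, 514, 126, 373, 345],
  [146, 183, 939, 662, 403, 996, 887, 17, 967, 47, 34, 530, 787, 923, 584, 574, 780, 475, 251, 92, 703, 22, 939, 202, 912, 521, 381, 430, 928, 837, 535, 167, 500, 106, 374, 34, 547, 404, 131, 640, 415, 125, 327, 748, 793, 414, 183, 662, 937, 394, 960, 284, 382, 172, 659, 262, 96, 94, 253, 675, 401, 746, 671],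
  [673, 622, 765, 989, 753, 747, 612, 734, 952, 188, 524, 9, 913, 566, 317, 292, 736, 823, 7, 791, 605, 198, 568, 101, 456, 18, 428, 808, 317, 119, 73, 334, 509, 456, 499, 238, 794, 751, 131, 155, 221, 375, 965, 471, 453, 276, 885, 553, 877, 794, 923, 426, 382, 835, 414, 262, 32, 481, 754, 450, 841, 495, 834],
  [241, 605, 69, 973, 692, 311, 148, 374, 431, 752, 393, 145, 764, 90, 464, 819, 582, 939, 28, 678, 142, 785, 282, 549, 228, 812, 855, 934, 292, 491, 146, 668, 572, 532, 2, 669, 788, 594, 131, 279, 627, 128, 805, 34, 211, 184, 913, 849, 757, 97, 849, 639, 382, 454, 602, 262, 343, 987, 592, 300, 548, 990, 417],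
  [201, 568, 559, 405, 448, 440, 380, 415, 937, 537, 355, 858, 655, 360, 575, 174, 214, 428, 351, 772, 278, 407, 383, 934, 147, 599, 544, 430, 846, 892, 383, 613, 336, 629, 888, 717, 591, 337, 545, 377, 576, 457, 331, 168, 815, 414, 488, 933, 862, 461, 360, 316, 788, 535, 608, 262, 672, 911, 353, 884, 63, 581, 690],
  [469, 732, 242, 218, 560, 330, 333, 676, 907, 154, 17, 530, 262, 480, 546, 290, 749, 475, 407, 92, 703, 672, 306, 467, 572, 878, 127, 808, 188, 857, 766, 229, 358, 900, 561, 34, 579, 86, 545, 878, 768, 374, 989, 463, 844, 276, 366, 311, 727, 595, 720, 474, 788, 667, 152, 262, 224, 663, 256, 257, 699, 165, 345],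
  [762, 494, 968, 654, 700, 746, 667, 157, 862, 616, 262, 9, 703, 640, 730, 151, 129, 823, 631, 791, 605, 66, 510, 732, 286, 503, 475, 934, 928, 478, 535, 458, 512, 53, 250, 238, 547, 303, 545, 384, 27, 125, 949, 914, 589, 184, 773, 436, 457, 197, 443, 711, 788, 334, 38, 262, 407, 94, 759, 836, 919, 330, 671],
  [781, 426, 881, 965, 875, 61, 839, 914, 296, 470, 695, 145, 680, 521, 147, 584, 950, 939, 530, 678, 142, 594, 850, 366, 143, 203, 285, 976, 317, 305, 73, 916, 593, 228, 3, 669, 794, 314, 545, 93, 36, 375, 709, 157, 906, 455, 829, 810, 914, 397, 886, 568, 788, 381, 508, 262, 468, 481, 268, 225, 274, 660, 834],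
  [134, 934, 778, 623, 224, 770, 143, 783, 727, 844, 507, 530, 917, 120, 968, 348, 856, 475, 84, 92, 703, 224, 689, 976, 866, 718, 707, 934, 846, 376, 383, 517, 33, 813, 343, 34, 591, 502, 867, 625, 960, 457, 985, 56, 633, 184, 732, 494, 779, 729, 540, 89, 23, 865, 380, 262, 855, 911, 62, 442, 848, 110, 690],
  [645, 979, 121, 872, 280, 79, 2, 437, 592, 385, 131, 9, 965, 160, 184, 580, 5, 823, 336, 791, 605, 22, 816, 488, 433, 375, 823, 976, 188, 169, 766, 37, 231, 450, 375, 238, 579, 563, 867, 128, 283, 374, 925, 819, 691, 455, 549, 497, 561, 796, 83, 632, 23, 333, 95, 262, 285, 663, 768, 627, 958, 220, 345],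
  [508, 707, 484, 622, 350, 807, 7, 277, 888, 543, 846, 145, 386, 878, 414, 302, 516, 939, 347, 678, 142, 198, 363, 244, 715, 300, 95, 990, 928, 890, 535, 74, 620, 525, 503, 669, 547, 975, 867, 31, 45, 125, 565, 637, 181, 968, 661, 498, 125, 597, 166, 948, 23, 950, 273, 262, 95, 94, 283, 418, 137, 440, 671],
  [754, 925, 389, 498, 112, 849, 429, 956, 779, 116, 564, 9, 885, 40, 213, 696, 433, 823, 378, 791, 605, 672, 508, 990, 171, 343, 939, 990, 846, 771, 383, 397, 297, 905, 64, 238, 591, 875, 342, 375, 603, 457, 889, 351, 269, 968, 101, 985, 32, 863, 810, 451, 298, 532, 736, 262, 665, 911, 186, 221, 479, 479, 690],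
  [430, 834, 559, 497, 140, 886, 6, 517, 670, 464, 423, 145, 354, 718, 230, 163, 20, 939, 515, 678, 142, 66, 182, 495, 584, 75, 364, 330, 188, 31, 766, 794, 85, 225, 256, 669, 579, 173, 342, 675, 804, 374, 349, 273, 385, 313, 325, 993, 64, 398, 623, 178, 298, 380, 184, 262, 554, 663, 310, 812, 567, 958, 345],
  [835, 345, 693, 995, 56, 738, 290, 677, 16, 290, 710, 145, 242, 678, 17, 395, 735, 939, 704, 678, 142, 22, 690, 330, 926, 268, 786, 110, 846, 401, 383, 247, 679, 951, 384, 669, 591, 407, 266, 225, 8, 457, 25, 117, 538, 541, 650, 965, 288, 930, 218, 269, 740, 152, 460, 262, 628, 911, 558, 609, 782, 971, 690]]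

/-- Its inverse mod 997. -/
def syzL : List (List ℕ) := [
  [311, 383, 744, 520, 36, 267, 577, 534, 432, 803, 275, 989, 583, 989, 982, 614, 224, 839, 843, 309, 355, 777, 388, 517, 230, 640, 574, 28, 406, 644, 705, 909, 264, 13, 81, 451, 442, 346, 182, 222, 251, 487, 612, 703, 399, 677, 645, 356, 705, 768, 88, 964, 764, 471, 9, 820, 216, 34, 691, 396, 739, 616, 761],
  [392, 215, 391, 297, 466, 516, 165, 697, 114, 18, 243, 675, 235, 876, 722, 47, 718, 335, 780, 250, 180, 851, 185, 925, 974, 960, 714, 693, 930, 828, 179, 148, 790, 624, 557, 778, 709, 933, 201, 435, 971, 878, 908, 806, 581, 511, 285, 48, 731, 311, 601, 304, 497, 706, 250, 896, 569, 104, 263, 255, 420, 456, 294],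
  [514, 199, 968, 969, 566, 718, 518, 51, 65, 72, 700, 48, 920, 158, 405, 256, 829, 867, 591, 410, 177, 266, 906, 518, 748, 515, 93, 854, 269, 393, 579, 682, 550, 22, 519, 784, 747, 99, 713, 500, 65, 218, 734, 652, 390, 388, 330, 692, 582, 571, 7, 357, 93, 272, 403, 758, 934, 738, 87, 250, 554, 329, 609],
  [458, 33, 112, 470, 53, 749, 895, 129, 841, 816, 124, 522, 972, 532, 303, 656, 779, 590, 115, 768, 826, 966, 326, 724, 877, 422, 860, 782, 274, 68, 972, 962, 4, 865, 725, 412, 503, 50, 16, 506, 816, 392, 361, 826, 711, 54, 664, 274, 500, 421, 53, 443, 443, 548, 209, 601, 792, 279, 551, 846, 757, 787, 817],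
  [814, 675, 139, 376, 864, 528, 603, 22, 218, 178, 635, 409, 884, 993, 825, 50, 793, 30, 563, 131, 697, 811, 60, 897, 255, 53, 876, 39, 308, 474, 2, 345, 931, 476, 991, 391, 207, 532, 451, 29, 346, 886, 382, 881, 209, 672, 914, 730, 418, 233, 495, 315, 157, 279, 457, 319, 162, 315, 688, 668, 102, 861, 468],
  [156, 299, 498, 502, 630, 525, 407, 817, 421, 192, 274, 704, 304, 236, 279, 538, 352, 96, 609, 288, 58, 30, 450, 805, 179, 193, 503, 801, 133, 404, 750, 744, 742, 126, 220, 793, 527, 478, 743, 887, 240, 472, 608, 985, 171, 627, 947, 403, 488, 970, 819, 495, 290, 956, 640, 987, 680, 13, 793, 555, 315, 882, 496],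
  [939, 88, 952, 232, 239, 148, 665, 87, 86, 415, 771, 76, 106, 269, 90, 158, 777, 811, 401, 563, 251, 12, 173, 969, 692, 763, 884, 988, 644, 42, 142, 420, 378, 703, 397, 217, 456, 680, 550, 833, 449, 611, 206, 337, 880, 318, 213, 261, 652, 623, 518, 571, 863, 912, 722, 985, 506, 803, 965, 384, 747, 510, 737],
  [817, 112, 799, 562, 607, 597, 695, 94, 31, 769, 75, 177, 624, 854, 756, 773, 23, 379, 864, 549, 835, 986, 486, 252, 264, 884, 106, 761, 448, 124, 477, 321, 962, 324, 552, 514, 785, 287, 14, 416, 698, 882, 346, 373, 267, 936, 625, 612, 308, 92, 101, 773, 62, 722, 966, 55, 920, 196, 11, 964, 254, 801, 875],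
  [652, 446, 136, 918, 254, 496, 269, 234, 189, 730, 555, 663, 909, 994, 390, 409, 504, 656, 692, 83, 689, 722, 167, 180, 99, 556, 672, 134, 263, 873, 714, 122, 789, 188, 614, 656, 982, 645, 848, 807, 563, 696, 308, 101, 391, 285, 716, 527, 681, 640, 798, 48, 921, 371, 71, 654, 668, 609, 378, 959, 333, 722, 903],
  [718, 911, 787, 599, 896, 56, 680, 651, 698, 797, 709, 115, 424, 99, 506, 753, 618, 956, 322, 379, 846, 697, 600, 950, 13, 321, 292, 126, 170, 299, 558, 306, 562, 891, 964, 777, 278, 486, 68, 681, 780, 349, 845, 14, 53, 171, 440, 511, 409, 348, 126, 277, 281, 570, 336, 42, 54, 762, 736, 281, 923, 232, 423],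
  [94, 585, 728, 916, 843, 771, 719, 713, 140, 917, 422, 719, 634, 570, 615, 857, 549, 715, 987, 917, 554, 671, 597, 966, 594, 677, 123, 862, 575, 303, 37, 215, 606, 506, 909, 674, 745, 335, 248, 150, 106, 700, 81, 56, 834, 225, 683, 304, 708, 304, 154, 439, 505, 37, 551, 145, 163, 218, 117, 852, 142, 629, 992],
  [672, 909, 540, 345, 504, 168, 719, 197, 833, 927, 928, 642, 321, 784, 3, 422, 389, 110, 774, 657, 553, 335, 544, 695, 522, 431, 185, 995, 95, 891, 957, 706, 804, 225, 273, 68, 408, 336, 810, 565, 19, 76, 302, 697, 954, 69, 886, 822, 789, 986, 294, 314, 43, 863, 279, 646, 100, 552, 121, 767, 827, 661, 547],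
  [776, 832, 321, 142, 481, 860, 153, 79, 788, 277, 553, 895, 7, 140, 700, 353, 602, 236, 392, 681, 642, 726, 783, 538, 444, 470, 472, 58, 976, 15, 829, 902, 560, 964, 570, 238, 953, 743, 979, 985, 364, 802, 788, 519, 128, 596, 6, 766, 305, 376, 971, 445, 4, 94, 660, 55, 251, 943, 908, 22, 867, 379, 828],
  [320, 403, 524, 491, 116, 887, 979, 244, 145, 442, 965, 23, 519, 106, 863, 934, 857, 882, 407, 513, 318, 771, 546, 141, 600, 392, 33, 821, 884, 772, 676, 621, 963, 543, 785, 530, 177, 137, 348, 405, 398, 267, 932, 643, 274, 786, 665, 301, 828, 36, 606, 584, 177, 135, 94, 269, 594, 746, 621, 754, 504, 618, 617],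
  [270, 957, 791, 733, 587, 438, 814, 105, 79, 588, 467, 924, 630, 756, 473, 60, 944, 163, 885, 129, 902, 712, 107, 126, 698, 582, 221, 801, 501, 329, 661, 995, 746, 615, 516, 952, 332, 689, 320, 759, 416, 9, 427, 672, 385, 239, 825, 274, 256, 381, 503, 231, 477, 868, 436, 847, 326, 898, 773, 699, 465, 643, 526],
  [806, 774, 946, 484, 115, 10, 216, 593, 212, 414, 594, 359, 664, 529, 624, 415, 62, 466, 171, 775, 23, 418, 967, 400, 833, 11, 708, 914, 36, 986, 80, 58, 57, 37, 693, 204, 402, 35, 659, 995, 939, 427, 915, 679, 860, 572, 835, 47, 941, 508, 110, 478, 115, 860, 895, 351, 658, 501, 314, 284, 623, 518, 725],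
  [948, 716, 352, 777, 665, 837, 949, 49, 857, 755, 820, 324, 604, 495, 189, 674, 820, 961, 93, 700, 743, 805, 202, 119, 315, 678, 925, 733, 35, 555, 222, 66, 943, 360, 270, 714, 373, 545, 778, 698, 830, 465, 761, 227, 453, 759, 896, 55, 487, 36, 648, 254, 495, 244, 943, 37, 614, 370, 684, 389, 51, 235, 137],
  [605, 106, 91, 152, 538, 40, 238, 382, 848, 75, 436, 672, 953, 781, 236, 426, 472, 153, 479, 390, 39, 583, 769, 408, 503, 898, 916, 940, 437, 971, 725, 478, 110, 325, 531, 830, 555, 491, 114, 541, 764, 79, 427, 444, 640, 807, 717, 313, 515, 872, 746, 327, 932, 996, 978, 481, 653, 324, 526, 950, 195, 516, 854],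
  [876, 216, 866, 748, 574, 130, 34, 243, 971, 414, 850, 516, 89, 33, 859, 384, 437, 850, 257, 486, 491, 680, 808, 358, 473, 931, 278, 43, 359, 669, 333, 698, 427, 870, 515, 515, 637, 906, 989, 548, 967, 100, 217, 500, 834, 932, 395, 334, 8, 566, 423, 487, 358, 140, 620, 221, 565, 182, 895, 748, 365, 920, 566],
  [670, 731, 382, 481, 732, 712, 8, 189, 793, 465, 916, 530, 363, 376, 188, 329, 562, 586, 199, 280, 447, 597, 701, 801, 557, 480, 785, 260, 683, 781, 233, 349, 408, 294, 490, 39, 953, 992, 680, 276, 387, 42, 624, 828, 615, 52, 838, 811, 450, 35, 527, 21, 224, 947, 961, 82, 326, 851, 526, 57, 680, 121, 938],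
  [323, 578, 427, 147, 576, 259, 523, 702, 657, 404, 603, 838, 221, 434, 12, 502, 803, 672, 243, 198, 840, 909, 399, 412, 529, 378, 328, 933, 127, 537, 397, 135, 653, 5, 456, 662, 640, 841, 856, 750, 781, 903, 666, 696, 577, 178, 772, 483, 509, 715, 84, 47, 214, 877, 180, 91, 545, 817, 298, 453, 88, 151, 976],
  [908, 586, 174, 853, 663, 783, 85, 26, 907, 23, 798, 521, 253, 341, 844, 437, 46, 199, 481, 945, 145, 324, 493, 247, 694, 447, 415, 46, 571, 897, 979, 596, 49, 667, 332, 874, 21, 141, 700, 160, 280, 967, 662, 128, 435, 586, 335, 302, 397, 93, 340, 912, 142, 663, 678, 86, 950, 237, 576, 440, 810, 90, 235],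
  [698, 194, 974, 474, 365, 50, 258, 160, 752, 583, 281, 34, 812, 658, 125, 387, 2, 210, 314, 19, 715, 800, 443, 354, 165, 85, 992, 567, 793, 945, 382, 271, 468, 288, 943, 170, 221, 78, 447, 573, 916, 601, 781, 481, 500, 129, 851, 289, 536, 640, 373, 799, 195, 32, 195, 560, 876, 374, 889, 139, 792, 260, 516],
  [981, 1, 394, 358, 544, 525, 738, 908, 587, 878, 403, 950, 492, 899, 713, 373, 509, 954, 149, 207, 253, 244, 63, 942, 140, 30, 611, 145, 510, 524, 792, 50, 262, 562, 746, 105, 626, 818, 123, 126, 639, 432, 381, 181, 702, 400, 226, 477, 222, 725, 184, 199, 742, 951, 946, 862, 73, 517, 589, 678, 590, 476, 265],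
  [171, 728, 660, 475, 375, 615, 141, 461, 454, 255, 618, 815, 451, 286, 47, 37, 894, 533, 774, 246, 476, 79, 168, 680, 271, 485, 475, 797, 21, 568, 445, 196, 595, 850, 451, 262, 947, 719, 788, 548, 477, 847, 222, 870, 376, 292, 406, 437, 44, 2, 381, 669, 947, 954, 541, 387, 38, 673, 305, 447, 910, 127, 526],
  [165, 554, 802, 532, 542, 164, 761, 130, 146, 14, 462, 477, 454, 370, 362, 153, 990, 407, 474, 843, 155, 250, 440, 774, 899, 417, 671, 601, 418, 852, 865, 297, 654, 12, 313, 623, 228, 227, 501, 797, 493, 955, 530, 359, 228, 393, 214, 485, 686, 849, 831, 122, 530, 44, 839, 167, 163, 252, 601, 176, 832, 575, 739],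
  [725, 187, 839, 389, 436, 699, 943, 162, 747, 129, 210, 824, 215, 783, 905, 281, 414, 574, 184, 271, 206, 287, 599, 863, 303, 201, 696, 268, 72, 65, 549, 615, 669, 330, 689, 47, 165, 214, 490, 787, 334, 891, 915, 295, 639, 801, 210, 978, 42, 673, 957, 750, 300, 744, 216, 656, 310, 989, 33, 682, 897, 935, 82],
  [776, 171, 836, 904, 23, 406, 597, 192, 129, 981, 892, 351, 112, 873, 395, 758, 71, 339, 264, 37, 449, 825, 242, 48, 142, 922, 351, 895, 321, 599, 598, 709, 84, 287, 925, 50, 835, 132, 242, 380, 685, 810, 248, 101, 643, 91, 561, 8, 201, 357, 783, 480, 351, 202, 887, 733, 793, 508, 950, 192, 245, 471, 148],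
  [699, 591, 416, 376, 339, 95, 154, 279, 756, 847, 271, 633, 925, 570, 834, 883, 909, 70, 612, 711, 335, 223, 272, 684, 349, 777, 991, 16, 308, 515, 134, 36, 88, 12, 345, 108, 257, 604, 751, 125, 695, 609, 387, 258, 245, 149, 626, 607, 229, 722, 192, 354, 696, 908, 636, 859, 903, 116, 515, 872, 239, 847, 869],
  [428, 711, 805, 612, 661, 650, 901, 260, 319, 65, 191, 266, 786, 884, 615, 839, 735, 436, 738, 734, 225, 774, 192, 827, 602, 646, 739, 539, 343, 331, 973, 808, 244, 655, 547, 155, 291, 330, 570, 46, 272, 526, 427, 897, 632, 302, 776, 18, 559, 419, 311, 342, 116, 774, 71, 820, 111, 578, 317, 926, 621, 62, 981],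
  [622, 872, 166, 57, 669, 901, 349, 966, 841, 794, 404, 364, 740, 471, 772, 734, 429, 467, 606, 797, 971, 798, 378, 540, 213, 39, 304, 9, 209, 41, 915, 666, 974, 342, 20, 298, 910, 18, 818, 362, 185, 34, 14, 666, 539, 497, 537, 385, 224, 396, 787, 914, 386, 964, 895, 733, 546, 845, 436, 394, 536, 608, 787],
  [103, 581, 163, 593, 993, 671, 899, 147, 612, 455, 965, 402, 815, 658, 344, 499, 891, 410, 913, 328, 210, 614, 302, 783, 690, 661, 671, 872, 985, 234, 322, 658, 626, 955, 960, 429, 841, 69, 237, 405, 167, 673, 10, 212, 461, 252, 978, 792, 634, 754, 599, 762, 26, 643, 876, 945, 183, 468, 174, 267, 613, 909, 503],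
  [489, 415, 289, 269, 127, 366, 458, 438, 82, 878, 104, 743, 105, 801, 346, 753, 693, 780, 857, 421, 626, 332, 292, 768, 385, 334, 267, 405, 529, 801, 874, 331, 40, 461, 561, 263, 229, 178, 284, 196, 475, 288, 143, 761, 963, 392, 342, 548, 890, 982, 296, 723, 240, 444, 502, 539, 485, 540, 253, 23, 711, 527, 589],
  [90, 986, 515, 118, 633, 848, 780, 79, 80, 11, 308, 169, 908, 664, 414, 588, 526, 657, 231, 914, 463, 307, 683, 599, 938, 817, 342, 910, 104, 736, 96, 460, 74, 138, 883, 628, 801, 64, 86, 794, 566, 759, 982, 226, 250, 451, 559, 268, 487, 518, 475, 254, 554, 716, 135, 14, 120, 650, 960, 911, 126, 356, 878],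
  [333, 679, 100, 296, 760, 853, 468, 418, 456, 857, 154, 988, 769, 469, 182, 226, 31, 95, 937, 517, 862, 923, 516, 457, 556, 811, 933, 117, 410, 728, 659, 432, 253, 811, 589, 617, 987, 597, 940, 194, 684, 5, 819, 584, 599, 23, 480, 785, 94, 728, 21, 412, 303, 150, 69, 832, 823, 564, 763, 244, 237, 380, 553],
  [941, 691, 491, 455, 591, 962, 2, 358, 526, 681, 955, 92, 174, 181, 909, 283, 932, 706, 612, 157, 722, 209, 335, 563, 522, 949, 584, 842, 943, 838, 919, 630, 94, 436, 915, 975, 168, 987, 810, 577, 428, 367, 794, 930, 488, 519, 552, 655, 238, 132, 409, 422, 416, 42, 981, 186, 436, 953, 834, 460, 491, 528, 188],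
  [262, 217, 126, 39, 982, 441, 555, 334, 847, 241, 612, 817, 60, 556, 232, 197, 93, 191, 18, 396, 825, 261, 874, 117, 410, 50, 937, 651, 941, 322, 846, 332, 604, 478, 576, 205, 423, 7, 322, 354, 317, 977, 190, 121, 166, 647, 334, 955, 400, 288, 167, 346, 507, 868, 942, 900, 712, 37, 404, 30, 786, 949, 38],
  [735, 690, 270, 889, 785, 426, 24, 923, 285, 99, 371, 537, 462, 447, 534, 897, 602, 282, 210, 81, 447, 566, 707, 477, 32, 677, 483, 482, 142, 796, 886, 864, 337, 972, 29, 232, 551, 178, 303, 532, 32, 18, 86, 943, 33, 83, 950, 181, 216, 286, 557, 201, 442, 256, 396, 179, 424, 587, 878, 755, 305, 927, 708],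
  [865, 966, 925, 12, 65, 727, 243, 548, 186, 512, 340, 927, 451, 119, 386, 266, 866, 530, 440, 382, 846, 956, 627, 576, 35, 6, 361, 318, 492, 265, 307, 5, 428, 188, 923, 139, 234, 200, 181, 746, 73, 913, 897, 272, 407, 178, 851, 974, 408, 519, 935, 263, 958, 97, 404, 346, 95, 716, 969, 942, 527, 984, 80],
  [593, 832, 329, 647, 291, 136, 569, 870, 914, 593, 829, 403, 18, 180, 141, 597, 319, 889, 966, 672, 642, 175, 296, 245, 410, 689, 650, 764, 97, 303, 311, 510, 537, 884, 245, 762, 912, 606, 593, 978, 894, 511, 922, 167, 421, 537, 289, 90, 902, 560, 418, 184, 516, 6, 484, 812, 742, 442, 325, 263, 688, 779, 78],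
  [499, 787, 585, 942, 141, 588, 105, 511, 98, 172, 208, 348, 44, 164, 210, 835, 693, 249, 415, 121, 46, 665, 930, 781, 248, 100, 879, 742, 511, 35, 784, 453, 645, 322, 537, 885, 63, 406, 143, 158, 644, 896, 674, 427, 461, 211, 629, 216, 51, 598, 23, 924, 320, 707, 261, 19, 815, 898, 696, 947, 469, 923, 128],
  [665, 527, 394, 801, 594, 160, 446, 578, 61, 492, 211, 112, 201, 968, 943, 20, 4, 781, 412, 788, 251, 277, 66, 36, 803, 321, 404, 343, 865, 453, 2, 331, 113, 45, 56, 408, 380, 309, 110, 88, 749, 553, 223, 585, 219, 790, 283, 880, 735, 481, 104, 560, 303, 957, 616, 577, 466, 212, 727, 374, 623, 574, 373],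
  [700, 338, 986, 517, 629, 604, 889, 164, 202, 597, 472, 371, 795, 695, 230, 983, 558, 117, 840, 531, 784, 119, 780, 941, 313, 396, 156, 955, 390, 402, 386, 420, 200, 666, 78, 890, 272, 27, 577, 164, 922, 578, 947, 975, 819, 512, 892, 881, 494, 653, 368, 590, 506, 71, 545, 695, 955, 87, 541, 681, 24, 514, 852],
  [460, 534, 867, 537, 84, 669, 612, 893, 969, 601, 833, 109, 895, 628, 311, 239, 40, 359, 342, 302, 0, 719, 884, 631, 532, 670, 597, 915, 943, 293, 845, 122, 931, 634, 218, 311, 702, 463, 853, 856, 460, 488, 788, 113, 813, 788, 836, 151, 681, 422, 640, 581, 861, 289, 504, 321, 44, 395, 446, 689, 588, 258, 582],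
  [971, 241, 947, 241, 644, 850, 365, 358, 448, 348, 298, 675, 840, 747, 651, 521, 6, 209, 674, 481, 299, 598, 169, 434, 467, 715, 927, 163, 888, 141, 883, 908, 583, 548, 214, 314, 820, 357, 258, 794, 986, 432, 973, 616, 755, 158, 91, 262, 451, 575, 573, 808, 251, 322, 253, 390, 780, 498, 703, 245, 223, 487, 356],
  [128, 576, 867, 150, 505, 92, 153, 625, 786, 747, 293, 909, 889, 91, 307, 453, 38, 735, 568, 329, 857, 825, 949, 66, 710, 287, 947, 522, 884, 410, 595, 418, 504, 326, 913, 131, 209, 344, 410, 688, 530, 455, 548, 352, 277, 532, 333, 27, 83, 544, 961, 743, 135, 924, 485, 880, 693, 39, 550, 834, 857, 885, 571],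
  [479, 88, 922, 425, 701, 219, 127, 653, 597, 535, 969, 885, 481, 437, 35, 948, 333, 22, 94, 294, 111, 560, 801, 39, 961, 317, 307, 829, 559, 522, 714, 648, 992, 88, 184, 540, 73, 913, 74, 901, 49, 64, 738, 321, 613, 753, 344, 692, 300, 362, 609, 854, 312, 885, 528, 519, 120, 468, 654, 508, 429, 987, 246],
  [445, 904, 166, 395, 188, 637, 900, 119, 875, 820, 462, 817, 627, 975, 191, 676, 657, 946, 515, 430, 332, 817, 440, 347, 584, 112, 220, 80, 133, 348, 530, 70, 756, 994, 601, 265, 920, 145, 195, 667, 715, 305, 271, 579, 950, 177, 74, 278, 193, 712, 109, 894, 8, 811, 891, 153, 303, 351, 845, 598, 427, 926, 715],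
  [51, 426, 666, 573, 357, 550, 373, 476, 505, 518, 493, 846, 937, 548, 470, 987, 521, 411, 738, 863, 201, 671, 92, 591, 26, 158, 103, 899, 992, 376, 806, 258, 926, 8, 556, 656, 778, 613, 83, 991, 540, 51, 666, 683, 73, 272, 816, 721, 618, 269, 733, 780, 954, 942, 150, 212, 826, 853, 330, 817, 146, 349, 991],
  [136, 297, 960, 200, 836, 381, 760, 777, 320, 958, 777, 425, 462, 185, 821, 287, 496, 21, 385, 354, 546, 919, 421, 14, 813, 207, 463, 174, 24, 361, 978, 89, 463, 305, 810, 166, 591, 183, 711, 827, 232, 299, 58, 667, 382, 1, 310, 594, 849, 513, 988, 370, 547, 320, 538, 446, 152, 312, 317, 32, 361, 737, 221],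
  [260, 382, 744, 428, 600, 178, 975, 570, 481, 411, 165, 550, 718, 56, 35, 703, 71, 882, 261, 399, 440, 521, 510, 303, 182, 186, 176, 575, 894, 267, 146, 501, 554, 81, 550, 954, 745, 780, 638, 695, 455, 746, 356, 567, 495, 775, 876, 687, 605, 61, 378, 626, 410, 54, 735, 411, 757, 764, 774, 897, 532, 815, 232],
  [715, 293, 477, 615, 282, 544, 890, 736, 305, 771, 372, 728, 719, 653, 170, 450, 218, 829, 241, 256, 419, 2, 362, 740, 545, 942, 818, 770, 40, 484, 261, 944, 289, 523, 741, 564, 377, 693, 649, 208, 742, 278, 534, 198, 644, 548, 448, 308, 886, 355, 661, 801, 682, 700, 28, 195, 181, 992, 83, 27, 778, 960, 217],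
  [539, 703, 343, 152, 490, 98, 948, 38, 566, 141, 413, 326, 129, 311, 358, 781, 415, 802, 9, 583, 565, 303, 887, 820, 681, 522, 484, 194, 378, 630, 446, 617, 995, 403, 212, 362, 991, 576, 178, 24, 119, 541, 495, 504, 396, 132, 673, 522, 543, 758, 577, 854, 495, 205, 19, 306, 881, 15, 813, 603, 340, 592, 544],
  [612, 750, 562, 279, 539, 188, 338, 476, 69, 103, 239, 640, 783, 1, 207, 195, 605, 208, 141, 523, 489, 893, 882, 153, 394, 338, 282, 990, 277, 130, 830, 598, 114, 141, 488, 720, 322, 130, 105, 738, 966, 641, 744, 462, 106, 407, 547, 403, 263, 987, 595, 698, 88, 417, 773, 906, 392, 576, 785, 150, 877, 530, 705],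
  [476, 857, 692, 26, 442, 744, 477, 89, 255, 50, 786, 930, 919, 658, 992, 854, 442, 316, 72, 965, 893, 401, 249, 245, 245, 15, 165, 988, 698, 883, 272, 594, 344, 898, 395, 58, 73, 44, 336, 298, 634, 542, 264, 740, 471, 401, 206, 28, 296, 189, 142, 475, 57, 616, 647, 458, 143, 254, 356, 85, 138, 454, 692],
  [709, 46, 186, 153, 450, 939, 254, 393, 48, 356, 897, 361, 90, 750, 871, 680, 707, 125, 521, 778, 347, 12, 289, 452, 757, 581, 718, 611, 790, 347, 391, 778, 478, 556, 442, 512, 465, 297, 298, 336, 685, 318, 688, 304, 552, 428, 134, 503, 147, 775, 788, 65, 673, 193, 820, 72, 128, 211, 663, 881, 41, 345, 133],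
  [487, 807, 897, 198, 233, 28, 62, 853, 681, 807, 357, 519, 812, 509, 493, 498, 76, 723, 148, 869, 462, 445, 555, 441, 176, 749, 399, 170, 956, 717, 859, 192, 878, 169, 906, 521, 332, 826, 173, 314, 967, 304, 574, 776, 289, 704, 172, 832, 34, 972, 704, 406, 952, 496, 655, 240, 889, 21, 617, 64, 583, 996, 393],
  [253, 509, 10, 840, 451, 875, 813, 32, 872, 983, 356, 939, 466, 602, 803, 711, 834, 721, 200, 671, 711, 585, 157, 191, 317, 746, 485, 59, 141, 658, 553, 191, 546, 476, 607, 737, 993, 259, 553, 50, 613, 810, 106, 28, 154, 968, 70, 140, 461, 600, 694, 353, 953, 836, 164, 416, 83, 293, 840, 592, 754, 166, 410],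
  [648, 572, 181, 169, 35, 47, 122, 445, 166, 629, 479, 763, 268, 656, 476, 490, 39, 278, 589, 802, 486, 706, 242, 823, 581, 17, 435, 278, 667, 861, 697, 372, 375, 832, 814, 700, 963, 152, 588, 337, 571, 891, 638, 853, 602, 971, 4, 873, 836, 657, 553, 557, 417, 360, 299, 684, 315, 983, 116, 87, 95, 724, 762],
  [326, 425, 521, 320, 245, 906, 808, 210, 827, 647, 660, 245, 879, 842, 945, 250, 277, 149, 483, 836, 688, 594, 106, 74, 851, 183, 987, 916, 247, 61, 839, 804, 223, 817, 222, 347, 507, 786, 462, 635, 542, 771, 398, 60, 870, 342, 556, 290, 259, 363, 38, 976, 355, 968, 107, 894, 204, 417, 106, 670, 82, 754, 237],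
  [780, 597, 479, 177, 214, 354, 847, 465, 634, 106, 234, 815, 108, 27, 710, 738, 716, 255, 541, 369, 35, 479, 776, 454, 69, 648, 207, 766, 26, 64, 790, 173, 567, 633, 233, 495, 410, 261, 573, 623, 732, 265, 154, 395, 302, 953, 179, 707, 195, 372, 965, 68, 534, 234, 395, 371, 311, 715, 108, 178, 181, 404, 434],
  [301, 505, 944, 605, 477, 11, 778, 412, 209, 794, 234, 483, 69, 782, 174, 452, 83, 686, 382, 512, 22, 121, 805, 890, 327, 550, 31, 21, 410, 47, 845, 608, 585, 896, 711, 647, 250, 947, 360, 782, 647, 288, 466, 578, 9, 377, 820, 897, 839, 207, 157, 460, 300, 289, 925, 648, 452, 902, 862, 876, 408, 267, 900],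
  [527, 719, 994, 529, 228, 105, 42, 846, 894, 529, 755, 846, 216, 230, 102, 533, 938, 198, 56, 237, 184, 752, 887, 124, 856, 285, 775, 418, 17, 106, 552, 808, 452, 144, 926, 196, 218, 248, 717, 300, 461, 424, 645, 278, 51, 225, 442, 691, 895, 286, 774, 68, 955, 592, 806, 120, 485, 551, 876, 33, 93, 576, 170]]

def syzDot : List ℕ → List ℕ → ℕ
  | a :: as, b :: bs => a * b + syzDot as bs
  | _, _ => 0

theorem syzDot_eq : ∀ (n : ℕ) (l m : List ℕ), l.length ≤ n →
    syzDot l m = ∑ k ∈ Finset.range n, l.getD k 0 * m.getD k 0 := by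
  intro n
  induction n with
  | zero =>
    intro l m h
    have : l = [] := by simpa using h
    subst this
    simp [syzDot]
  | succ n ih =>
    intro l m h
    match l, m with
    | [], m => simp [syzDot]
    | a :: as, [] => simp [syzDot]
    | a :: as, b :: bs =>
      rw [Finset.sum_range_succ', syzDot, ih as bs (by simpa using h)]
      simp [add_comm]

def syzS (c0 c1 c2 c3 c4 c5 c6 c7 c8 l0 l1 l2 l3 l4 l5 l6 l7 l8 : ℤ) : ℤ :=
    c0 * (l1 * l2 * l3 * l4 * l5 * l6 * l7 * l8) +
    c1 * (l0 * l2 * l3 * l4 * l5 * l6 * l7 * l8) +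
    c2 * (l0 * l1 * l3 * l4 * l5 * l6 * l7 * l8) +
    c3 * (l0 * l1 * l2 * l4 * l5 * l6 * l7 * l8) +
    c4 * (l0 * l1 * l2 * l3 * l5 * l6 * l7 * l8) +
    c5 * (l0 * l1 * l2 * l3 * l4 * l6 * l7 * l8) +
    c6 * (l0 * l1 * l2 * l3 * l4 * l5 * l7 * l8) +
    c7 * (l0 * l1 * l2 * l3 * l4 * l5 * l6 * l8) +
    c8 * (l0 * l1 * l2 * l3 * l4 * l5 * l6 * l7)

def syzG0 (x y z : ℤ) : ℤ :=
  syzS 1 0 4 1 16 1 3 1 7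
    x y (4 * x - 5 * y - 5 * z) (x - y + z) (16 * x + 13 * y - 20 * z) (x + 3 * y - 3 * z)
    (3 * x + 2 * y + 3 * z) (x + 5 * y + 5 * z) (7 * x - 4 * y - z)

def syzG1 (x y z : ℤ) : ℤ :=
  syzS 0 1 (-5) (-1) 13 3 2 5 (-4)
    x y (4 * x - 5 * y - 5 * z) (x - y + z) (16 * x + 13 * y - 20 * z) (x + 3 * y - 3 * z)
    (3 * x + 2 * y + 3 * z) (x + 5 * y + 5 * z) (7 * x - 4 * y - z)

def syzG2 (x y z : ℤ) : ℤ :=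
  syzS 0 0 (-5) 1 (-20) (-3) 3 5 (-1)
    x y (4 * x - 5 * y - 5 * z) (x - y + z) (16 * x + 13 * y - 20 * z) (x + 3 * y - 3 * z)
    (3 * x + 2 * y + 3 * z) (x + 5 * y + 5 * z) (7 * x - 4 * y - z)

/-- The three partial derivatives at an integer point. -/
def syzG (t : ℕ) (x y z : ℤ) : ℤ :=
  match t with
  | 0 => syzG0 x y z
  | 1 => syzG1 x y z
  | _ => syzG2 x y z

theorem syz_leibniz (P : Fin 3 → ℂ) (t : Fin 3)
    (l0 l1 l2 l3 l4 l5 l6 l7 l8 : MvPolynomial (Fin 3) ℂ) :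
    eval P (pderiv t (l0 * l1 * l2 * l3 * l4 * l5 * l6 * l7 * l8)) =
    eval P (pderiv t l0) * (eval P l1 * eval P l2 * eval P l3 * eval P l4 * eval P l5 * eval P l6 * eval P l7 * eval P l8) +
    eval P (pderiv t l1) * (eval P l0 * eval P l2 * eval P l3 * eval P l4 * eval P l5 * eval P l6 * eval P l7 * eval P l8) +
    eval P (pderiv t l2) * (eval P l0 * eval P l1 * eval P l3 * eval P l4 * eval P l5 * eval P l6 * eval P l7 * eval P l8) +
    eval P (pderiv t l3) * (eval P l0 * eval P l1 * eval P l2 * eval P l4 * eval P l5 * eval P l6 * eval P l7 * eval P l8) +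
    eval P (pderiv t l4) * (eval P l0 * eval P l1 * eval P l2 * eval P l3 * eval P l5 * eval P l6 * eval P l7 * eval P l8) +
    eval P (pderiv t l5) * (eval P l0 * eval P l1 * eval P l2 * eval P l3 * eval P l4 * eval P l6 * eval P l7 * eval P l8) +
    eval P (pderiv t l6) * (eval P l0 * eval P l1 * eval P l2 * eval P l3 * eval P l4 * eval P l5 * eval P l7 * eval P l8) +
    eval P (pderiv t l7) * (eval P l0 * eval P l1 * eval P l2 * eval P l3 * eval P l4 * eval P l5 * eval P l6 * eval P l8) +
    eval P (pderiv t l8) * (eval P l0 * eval P l1 * eval P l2 * eval P l3 * eval P l4 * eval P l5 * eval P l6 * eval P l7) := by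
  simp only [pderiv_mul, map_add, map_mul]
  ring

theorem syzG_eval0 (x y z : ℤ) :
    eval ![(x : ℂ), (y : ℂ), (z : ℂ)] (pderiv 0 fA') = ((syzG 0 x y z : ℤ) : ℂ) := by
  change _ = ((syzG0 x y z : ℤ) : ℂ)
  unfold fA' syzG0 syzS
  refine (syz_leibniz _ _ _ _ _ _ _ _ _ _ _).trans ?_
  push_cast
  simp only [map_sub, map_add, map_nsmul, pderiv_X]
  simp

theorem syzG_eval1 (x y z : ℤ) :
    eval ![(x : ℂ), (y : ℂ), (z : ℂ)] (pderiv 1 fA') = ((syzG 1 x y z : ℤ) : ℂ) := by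
  change _ = ((syzG1 x y z : ℤ) : ℂ)
  unfold fA' syzG1 syzS
  refine (syz_leibniz _ _ _ _ _ _ _ _ _ _ _).trans ?_
  push_cast
  simp only [map_sub, map_add, map_nsmul, pderiv_X]
  simp

theorem syzG_eval2 (x y z : ℤ) :
    eval ![(x : ℂ), (y : ℂ), (z : ℂ)] (pderiv 2 fA') = ((syzG 2 x y z : ℤ) : ℂ) := by
  change _ = ((syzG2 x y z : ℤ) : ℂ)
  unfold fA' syzG2 syzS
  refine (syz_leibniz _ _ _ _ _ _ _ _ _ _ _).trans ?_
  push_cast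
  simp only [map_sub, map_add, map_nsmul, pderiv_X]
  simp

def syzMon (u : ℕ) (x y z : ℤ) : ℤ :=
  let e := syzE.getD u (0, 0, 0)
  x ^ e.1 * y ^ e.2.1 * z ^ e.2.2

def syzEntry (k t u : ℕ) : ℤ :=
  let P := syzPts.getD k (0, 0, 0)
  syzG t P.1 P.2.1 P.2.2 * syzMon u P.1 P.2.1 P.2.2

def syzTe (k j : ℕ) : ℕ := (syzT.getD j []).getD k 0
def syzLe (i k : ℕ) : ℕ := (syzL.getD i []).getD k 0

theorem syz_check_len : ∀ i < 63, (syzL.getD i []).length ≤ 63 := by decide +kernel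

theorem syz_check_T : ∀ k < 63, ∀ t < 3, ∀ u < 21,
    syzEntry k t u % 997 = ((syzTe k (t * 21 + u) : ℕ) : ℤ) := by decide +kernel

theorem syz_check_L : ∀ i < 63, ∀ j < 63,
    syzDot (syzL.getD i []) (syzT.getD j []) % 997 = if i = j then 1 else 0 := by decide +kernel

abbrev SyzIdx := Fin 3 × Fin 21

def syzIdx (q : SyzIdx) : ℕ := q.1 * 21 + q.2

theorem syzIdx_lt (q : SyzIdx) : syzIdx q < 63 := by
  obtain ⟨a, b⟩ := q
  simp only [syzIdx]; omega

theorem syzIdx_inj (q r : SyzIdx) (h : syzIdx q = syzIdx r) : q = r := by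
  obtain ⟨a, b⟩ := q
  obtain ⟨c, d⟩ := r
  simp only [syzIdx] at h
  ext <;> simp only <;> omega

def syzN : Matrix SyzIdx SyzIdx ℤ := fun i j =>
  ∑ k ∈ Finset.range 63, (syzLe (syzIdx i) k : ℤ) * syzEntry k j.1 j.2

theorem syzN_mod (i j : SyzIdx) : ((syzN i j : ℤ) : ZMod 997) = if i = j then 1 else 0 := by
  have h1 := syzDot_eq 63 (syzL.getD (syzIdx i) []) (syzT.getD (syzIdx j) [])
    (syz_check_len _ (syzIdx_lt i))
  have h2 := syz_check_L _ (syzIdx_lt i) _ (syzIdx_lt j)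
  have h3 : ((syzDot (syzL.getD (syzIdx i) []) (syzT.getD (syzIdx j) []) : ℕ) : ZMod 997)
      = if i = j then 1 else 0 := by
    rw [← ZMod.natCast_mod, h2]
    by_cases h : i = j
    · simp [h]
    · have : syzIdx i ≠ syzIdx j := fun h' => h (syzIdx_inj _ _ h')
      simp [h, this]
  rw [← h3, h1]
  simp only [syzN]
  push_cast
  refine Finset.sum_congr rfl fun k hk => ?_
  have h4 := syz_check_T k (Finset.mem_range.1 hk) j.1 j.1.2 j.2 j.2.2
  have h5 : ((syzEntry k j.1 j.2 : ℤ) : ZMod 997) = ((syzTe k (syzIdx j) : ℕ) : ZMod 997) := by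
    have : ((syzEntry k j.1 j.2 : ℤ) : ZMod 997) = ((syzEntry k j.1 j.2 % 997 : ℤ) : ZMod 997) :=
      (ZMod.intCast_mod _ 997).symm
    rw [this, h4]
    simp [syzIdx]
  rw [h5]
  rfl

theorem syzN_det : (syzN.map (Int.cast : ℤ → ℂ)).det ≠ 0 := by
  have h : syzN.map (Int.castRingHom (ZMod 997)) = 1 := by
    ext i j
    rw [Matrix.one_apply]
    exact syzN_mod i j
  have h0 : syzN.det ≠ 0 := by
    intro h0
    have h1 := RingHom.map_det (Int.castRingHom (ZMod 997)) syzN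
    rw [h0, RingHom.mapMatrix_apply, h, Matrix.det_one, map_zero] at h1
    exact absurd h1 (by decide)
  have h2 := RingHom.map_det (Int.castRingHom ℂ) syzN
  have h3 : (syzN.map (Int.cast : ℤ → ℂ)).det = ((syzN.det : ℤ) : ℂ) := h2.symm
  rw [h3]
  exact_mod_cast h0

noncomputable def syzEx (u : Fin 21) : Fin 3 →₀ ℕ :=
  Finsupp.equivFunOnFinite.symm
    ![(syzE.getD u (0, 0, 0)).1, (syzE.getD u (0, 0, 0)).2.1, (syzE.getD u (0, 0, 0)).2.2]

theorem syzE_inj : ∀ u v : Fin 21, syzE.getD u (0, 0, 0) = syzE.getD v (0, 0, 0) → u = v := by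
  decide +kernel

theorem syzE_surj : ∀ i < 6, ∀ j < 6, i + j ≤ 5 →
    ∃ u : Fin 21, syzE.getD u (0, 0, 0) = (i, j, 5 - i - j) := by
  decide +kernel

theorem syzEx_inj : Function.Injective syzEx := by
  intro u v h
  have h' := Finsupp.equivFunOnFinite.symm.injective h
  apply syzE_inj
  have h0 := congrFun h' 0
  have h1 := congrFun h' 1
  have h2 := congrFun h' 2
  exact Prod.ext h0 (Prod.ext h1 h2)

theorem syzEx_surj (d : Fin 3 →₀ ℕ) (hd : d 0 + d 1 + d 2 = 5) : ∃ u, syzEx u = d := by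
  obtain ⟨u, hu⟩ := syzE_surj (d 0) (by omega) (d 1) (by omega) (by omega)
  refine ⟨u, ?_⟩
  ext s
  fin_cases s <;> simp only [syzEx, hu] <;> simp
  omega

theorem syz_supp (a : MvPolynomial (Fin 3) ℂ) (ha : a.IsHomogeneous 5) (d : Fin 3 →₀ ℕ)
    (hd : coeff d a ≠ 0) : ∃ u, syzEx u = d := by
  apply syzEx_surj
  have h := ha hd
  have h' : d.degree = 5 := by
    rw [← h, Finsupp.degree_eq_weight_one]
    rfl
  rw [Finsupp.degree_eq_sum, Fin.sum_univ_three] at h'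
  exact h'

theorem syz_eval (a : MvPolynomial (Fin 3) ℂ) (ha : a.IsHomogeneous 5) (x y z : ℤ) :
    eval ![(x : ℂ), (y : ℂ), (z : ℂ)] a =
      ∑ u : Fin 21, ((syzMon u x y z : ℤ) : ℂ) * coeff (syzEx u) a := by
  classical
  rw [eval_eq']
  have h : a.support ⊆ Finset.univ.image syzEx := by
    intro d hd
    obtain ⟨u, hu⟩ := syz_supp a ha d (mem_support_iff.1 hd)
    exact Finset.mem_image.2 ⟨u, Finset.mem_univ _, hu⟩
  rw [Finset.sum_subset h, Finset.sum_image (fun u _ v _ h => syzEx_inj h)]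
  · refine Finset.sum_congr rfl fun u _ => ?_
    simp [syzMon, syzEx, Fin.prod_univ_three]
    ring
  · intro d _ hd
    rw [notMem_support_iff.1 hd, zero_mul]

theorem syz_zero (a : MvPolynomial (Fin 3) ℂ) (ha : a.IsHomogeneous 5)
    (h : ∀ u, coeff (syzEx u) a = 0) : a = 0 := by
  ext d
  rw [coeff_zero]
  by_contra hd
  obtain ⟨u, rfl⟩ := syz_supp a ha d hd
  exact hd (h u)

/-- There is no nonzero Jacobian syzygy of degree 5 for f'; i.e. mdr(f') ≥ 6. -/
theorem fA'_no_degree_five_syzygy :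
    ∀ a b c : MvPolynomial (Fin 3) ℂ,
      a.IsHomogeneous 5 → b.IsHomogeneous 5 → c.IsHomogeneous 5 →
      a * pderiv 0 fA' + b * pderiv 1 fA' + c * pderiv 2 fA' = 0 →
      a = 0 ∧ b = 0 ∧ c = 0 := by
  intro a b c ha hb hc h
  let w : Fin 3 → MvPolynomial (Fin 3) ℂ := ![a, b, c]
  let v : SyzIdx → ℂ := fun q => coeff (syzEx q.2) (w q.1)
  have hk : ∀ k : ℕ, ∑ j : SyzIdx, ((syzEntry k j.1 j.2 : ℤ) : ℂ) * v j = 0 := by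
    intro k
    set P := syzPts.getD k (0, 0, 0) with hP
    have h1 := congrArg (eval ![(P.1 : ℂ), (P.2.1 : ℂ), (P.2.2 : ℂ)]) h
    simp only [map_add, map_mul, map_zero, syzG_eval0, syzG_eval1, syzG_eval2, syz_eval a ha, syz_eval b hb,
      syz_eval c hc] at h1
    rw [Fintype.sum_prod_type, Fin.sum_univ_three]
    rw [← h1, Finset.sum_mul, Finset.sum_mul, Finset.sum_mul]
    congr 1
    · congr 1 <;>
      · refine Finset.sum_congr rfl fun u _ => ?_
        simp only [syzEntry, ← hP, v, w]
        push_cast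
        simp
        ring
    · refine Finset.sum_congr rfl fun u _ => ?_
      simp only [syzEntry, ← hP, v, w]
      push_cast
      simp
      ring
  have hv : v = 0 := by
    apply Matrix.eq_zero_of_mulVec_eq_zero syzN_det
    ext i
    simp only [Matrix.mulVec, dotProduct, Matrix.map_apply, syzN, Pi.zero_apply]
    push_cast
    simp only [Finset.sum_mul]
    rw [Finset.sum_comm]
    refine Finset.sum_eq_zero fun k _ => ?_
    have := hk k
    simp only [mul_assoc, ← Finset.mul_sum, this, mul_zero]
  exact ⟨syz_zero a ha fun u => congrFun hv (0, u), syz_zero b hb fun u => congrFun hv (1, u),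
    syz_zero c hc fun u => congrFun hv (2, u)⟩
end

section
/- Let g = ℓ₁ℓ₂ℓ₃ℓ₄ℓ₅ℓ₆ ∈ ℂ[x,y,z] be the product of six distinct linear forms whose associated line arrangement has only double points (15 nodes, i.e., the lines are in general position). Then mdr(g) = 4: there is a nonzero Jacobian syzygy of degree 4 for g and none of degree ≤ 3. -/
open MvPolynomial

namespace SixLines

/-- Explicit 3 by 3 determinant. -/
def dt (u v w : Fin 3 → ℂ) : ℂ :=
  u 0 * (v 1 * w 2 - v 2 * w 1) - u 1 * (v 0 * w 2 - v 2 * w 0) + u 2 * (v 0 * w 1 - v 1 * w 0)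

/-- Cross product. -/
def cr (u v : Fin 3 → ℂ) : Fin 3 → ℂ :=
  ![u 1 * v 2 - u 2 * v 1, u 2 * v 0 - u 0 * v 2, u 0 * v 1 - u 1 * v 0]

/-- Linear form with given coefficients. -/
noncomputable def lin (u : Fin 3 → ℂ) : MvPolynomial (Fin 3) ℂ :=
  C (u 0) * X 0 + C (u 1) * X 1 + C (u 2) * X 2

/-- The derivation with coefficients a, b, c. -/
noncomputable def der (a b c : MvPolynomial (Fin 3) ℂ) :
    Derivation ℂ (MvPolynomial (Fin 3) ℂ) (MvPolynomial (Fin 3) ℂ) :=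
  a • pderiv 0 + b • pderiv 1 + c • pderiv 2

lemma der_apply (a b c f : MvPolynomial (Fin 3) ℂ) :
    der a b c f = a * pderiv 0 f + b * pderiv 1 f + c * pderiv 2 f := by
  simp [der]

lemma der_lin (a b c : MvPolynomial (Fin 3) ℂ) (u : Fin 3 → ℂ) :
    der a b c (lin u) = C (u 0) * a + C (u 1) * b + C (u 2) * c := by
  simp [der, lin, pderiv_X]
  ring

lemma eval_lin (u p : Fin 3 → ℂ) :
    eval p (lin u) = u 0 * p 0 + u 1 * p 1 + u 2 * p 2 := by
  simp [lin]

lemma eq_C {f : MvPolynomial (Fin 3) ℂ} (h : f.IsHomogeneous 0) : ∃ t, f = C t := by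
  have := (totalDegree_zero_iff_isHomogeneous (p := f)).2 h
  exact ⟨_, (totalDegree_eq_zero_iff_eq_C).1 this⟩

lemma exists_lin {f : MvPolynomial (Fin 3) ℂ} (h : f.IsHomogeneous 1) : ∃ u, f = lin u := by
  have h1 : ∀ i, ∃ t, pderiv i f = C t := fun i => eq_C (by simpa using h.pderiv (i := i))
  choose u hu using h1
  refine ⟨u, ?_⟩
  have := h.sum_X_mul_pderiv
  simp only [Fin.sum_univ_three, hu, one_smul] at this
  rw [← this, lin]
  ring

lemma exists_quad {f : MvPolynomial (Fin 3) ℂ} (h : f.IsHomogeneous 2) :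
    ∃ M : Fin 3 → Fin 3 → ℂ, ∀ v, 2 * eval v f =
      v 0 * (M 0 0 * v 0 + M 0 1 * v 1 + M 0 2 * v 2) +
      v 1 * (M 1 0 * v 0 + M 1 1 * v 1 + M 1 2 * v 2) +
      v 2 * (M 2 0 * v 0 + M 2 1 * v 1 + M 2 2 * v 2) := by
  have h1 : ∀ i, ∃ u, pderiv i f = lin u := fun i => exists_lin (by simpa using h.pderiv (i := i))
  choose u hu using h1
  refine ⟨u, fun v => ?_⟩
  have := congrArg (eval v) h.sum_X_mul_pderiv
  simp only [Fin.sum_univ_three, hu, map_add, map_mul, eval_X, eval_lin] at this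
  rw [this]
  simp

lemma lin_homog (u : Fin 3 → ℂ) : (lin u).IsHomogeneous 1 :=
  ((isHomogeneous_C_mul_X _ _).add (isHomogeneous_C_mul_X _ _)).add (isHomogeneous_C_mul_X _ _)

lemma dt_ne {u v w : Fin 3 → ℂ} (h : LinearIndependent ℂ ![lin u, lin v, lin w]) :
    dt u v w ≠ 0 := by
  intro h0
  have hd : (Matrix.of ![u, v, w]).det = 0 := by
    rw [← h0, Matrix.det_fin_three]
    simp [dt]
    ring
  obtain ⟨t, ht, hz⟩ := Matrix.exists_vecMul_eq_zero_iff.2 hd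
  have e : ∀ j, t 0 * u j + t 1 * v j + t 2 * w j = 0 := fun j => by
    have := congrFun hz j
    simpa [Matrix.vecMul, dotProduct, Fin.sum_univ_three] using this
  rw [Fintype.linearIndependent_iff] at h
  apply ht
  funext i
  refine h t ?_ i
  have e' : ∀ j, (C (t 0) * C (u j) + C (t 1) * C (v j) + C (t 2) * C (w j) :
      MvPolynomial (Fin 3) ℂ) = 0 := fun j => by
    simpa using congrArg (C (σ := Fin 3)) (e j)
  simp only [Fin.sum_univ_three, lin, smul_eq_C_mul]
  simp
  linear_combination X 0 * e' 0 + X 1 * e' 1 + X 2 * e' 2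

lemma lin_prime {u : Fin 3 → ℂ} (h : lin u ≠ 0) : Prime (lin u) := by
  rw [← UniqueFactorizationMonoid.irreducible_iff_prime]
  refine irreducible_of_totalDegree_eq_one ((lin_homog u).totalDegree h) fun x hx => ?_
  rw [isUnit_iff_ne_zero]
  rintro rfl
  apply h
  ext i
  simpa using hx i

/-- A quadratic form vanishing at the six nodes of four generic lines is zero. -/
lemma quad_zero {f : MvPolynomial (Fin 3) ℂ} (hf : f.IsHomogeneous 2)
    (u v w s : Fin 3 → ℂ) (huvw : dt u v w ≠ 0) (huvs : dt u v s ≠ 0) (huws : dt u w s ≠ 0)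
    (hvws : dt v w s ≠ 0)
    (h1 : eval (cr u v) f = 0) (h2 : eval (cr u w) f = 0) (h3 : eval (cr v w) f = 0)
    (h4 : eval (cr u s) f = 0) (h5 : eval (cr v s) f = 0) (h6 : eval (cr w s) f = 0) :
    f = 0 := by
  obtain ⟨M, hM⟩ := exists_quad hf
  -- the bilinear form
  let B : (Fin 3 → ℂ) → (Fin 3 → ℂ) → ℂ := fun p q =>
      p 0 * (M 0 0 * q 0 + M 0 1 * q 1 + M 0 2 * q 2) +
      p 1 * (M 1 0 * q 0 + M 1 1 * q 1 + M 1 2 * q 2) +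
      p 2 * (M 2 0 * q 0 + M 2 1 * q 1 + M 2 2 * q 2)
  have hB : ∀ p, 2 * eval p f = B p p := hM
  have expand2 : ∀ (p q r : Fin 3 → ℂ) (α β γ : ℂ), (∀ i, γ * r i = α * p i + β * q i) →
      γ ^ 2 * B r r = α ^ 2 * B p p + β ^ 2 * B q q + α * β * (B p q + B q p) := by
    intro p q r α β γ h
    have : γ ^ 2 * B r r = B (fun i => γ * r i) (fun i => γ * r i) := by
      simp only [B]; ring
    rw [this]
    simp only [B, h]; ring
  have expand3 : ∀ (p q r x : Fin 3 → ℂ) (α β γ δ : ℂ),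
      (∀ i, δ * x i = α * p i + β * q i + γ * r i) →
      δ ^ 2 * B x x = α ^ 2 * B p p + β ^ 2 * B q q + γ ^ 2 * B r r + α * β * (B p q + B q p)
        + α * γ * (B p r + B r p) + β * γ * (B q r + B r q) := by
    intro p q r x α β γ δ h
    have : δ ^ 2 * B x x = B (fun i => δ * x i) (fun i => δ * x i) := by
      simp only [B]; ring
    rw [this]
    simp only [B, h]; ring
  have key : ∀ (p q r : Fin 3 → ℂ) (α β γ : ℂ), α ≠ 0 → β ≠ 0 →
      (∀ i, γ * r i = α * p i + β * q i) → eval p f = 0 → eval q f = 0 → eval r f = 0 →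
      B p q + B q p = 0 := by
    intro p q r α β γ hα hβ h hp hq hr
    have := expand2 p q r α β γ h
    rw [← hB, ← hB, ← hB, hp, hq, hr] at this
    have h' : α * β * (B p q + B q p) = 0 := by linear_combination -this
    simpa [hα, hβ] using h'
  have k1 : B (cr u v) (cr u w) + B (cr u w) (cr u v) = 0 :=
    key _ _ (cr u s) (-dt u w s) (dt u v s) (dt u v w) (neg_ne_zero.2 huws) huvs
      (fun i => by fin_cases i <;> simp [cr, dt] <;> ring) h1 h2 h4
  have k2 : B (cr u v) (cr v w) + B (cr v w) (cr u v) = 0 :=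
    key _ _ (cr v s) (-dt v w s) (dt u v s) (dt u v w) (neg_ne_zero.2 hvws) huvs
      (fun i => by fin_cases i <;> simp [cr, dt] <;> ring) h1 h3 h5
  have k3 : B (cr u w) (cr v w) + B (cr v w) (cr u w) = 0 :=
    key _ _ (cr w s) (-dt v w s) (dt u w s) (dt u v w) (neg_ne_zero.2 hvws) huws
      (fun i => by fin_cases i <;> simp [cr, dt] <;> ring) h2 h3 h6
  refine MvPolynomial.funext fun x => ?_
  have := expand3 (cr u v) (cr u w) (cr v w) x
    (x 0 * w 0 + x 1 * w 1 + x 2 * w 2) (-(x 0 * v 0 + x 1 * v 1 + x 2 * v 2))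
    (x 0 * u 0 + x 1 * u 1 + x 2 * u 2) (dt u v w)
    (fun i => by fin_cases i <;> simp [cr, dt] <;> ring)
  rw [k1, k2, k3, ← hB, ← hB, ← hB, ← hB, h1, h2, h3] at this
  simpa [huvw] using this

lemma factor_homog {l h f : MvPolynomial (Fin 3) ℂ} (hl : l.IsHomogeneous 1)
    (hf : f.IsHomogeneous 3) (e : f = l * h) :
    f = l * homogeneousComponent 2 h := by
  let _ : GradedAlgebra (homogeneousSubmodule (Fin 3) ℂ) := MvPolynomial.gradedAlgebra
  have h1 := DirectSum.coe_decompose_mul_add_of_left_mem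
    (homogeneousSubmodule (Fin 3) ℂ) (i := 1) (j := 2) (a := l) (b := h) hl
  rw [← e] at h1
  have h2 := homogeneousComponent_eq_self hf
  have h3 := MvPolynomial.decomposition.decompose'_apply f 3
  have h4 := MvPolynomial.decomposition.decompose'_apply h 2
  rw [← h4]
  exact (h2.symm.trans h3.symm).trans h1

lemma der_prod (a b c : MvPolynomial (Fin 3) ℂ) (l h : Fin 6 → MvPolynomial (Fin 3) ℂ)
    (hl : ∀ i, der a b c (l i) = l i * h i) :
    der a b c (∏ i, l i) = (∑ i, h i) * ∏ i, l i := by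
  simp only [Fin.prod_univ_six, Fin.sum_univ_six, Derivation.leibniz, hl, smul_eq_mul]
  ring

lemma exists_factor (A : Fin 6 → Fin 3 → ℂ)
    (hA : ∀ i j k, i ≠ j → j ≠ k → i ≠ k → LinearIndependent ℂ ![lin (A i), lin (A j), lin (A k)])
    (a b c : MvPolynomial (Fin 3) ℂ) (hD : der a b c (∏ i, lin (A i)) = 0) (k : Fin 6) :
    lin (A k) ∣ der a b c (lin (A k)) := by
  have hne : ∀ j, j ≠ k → LinearIndependent ℂ ![lin (A k), lin (A j)] := by
    intro j hj
    obtain ⟨m, hm1, hm2⟩ : ∃ m : Fin 6, m ≠ j ∧ m ≠ k := by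
      revert j k; decide
    have := hA k j m hj.symm hm1.symm hm2.symm
    have h2 := this.comp ![0, 1] (by decide)
    convert h2 using 1
    ext i
    fin_cases i <;> rfl
  have hp : Prime (lin (A k)) := by
    obtain ⟨m, hm⟩ : ∃ m : Fin 6, m ≠ k := exists_ne k
    exact lin_prime ((hne m hm).ne_zero 0)
  rw [← Finset.mul_prod_erase _ _ (Finset.mem_univ k), Derivation.leibniz] at hD
  simp only [smul_eq_mul] at hD
  have : lin (A k) ∣ (∏ j ∈ Finset.univ.erase k, lin (A j)) * der a b c (lin (A k)) :=
    ⟨-der a b c (∏ j ∈ Finset.univ.erase k, lin (A j)), by linear_combination hD⟩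
  rcases hp.dvd_or_dvd this with h | h
  · exfalso
    obtain ⟨j, hj, q, hq⟩ := (hp.dvd_finsetProd_iff _).1 h
    have hjk : j ≠ k := (Finset.mem_erase.1 hj).1
    have hli := hne j hjk
    have h0 : lin (A j) ≠ 0 := hli.ne_zero 1
    have hq0 : q ≠ 0 := by rintro rfl; simp [hq] at h0
    have hdeg := congrArg totalDegree hq
    rw [totalDegree_mul_of_isDomain hp.ne_zero hq0, (lin_homog _).totalDegree h0,
      (lin_homog _).totalDegree hp.ne_zero] at hdeg
    have hqC := totalDegree_eq_zero_iff_eq_C.1 (show q.totalDegree = 0 by omega)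
    rw [LinearIndependent.pair_iff] at hli
    have := (hli (coeff 0 q) (-1) (by
      rw [hq, smul_eq_C_mul, ← hqC]; simp only [neg_smul, one_smul]; ring)).2
    simp at this
  · exact h

lemma lower (A : Fin 6 → Fin 3 → ℂ)
    (hA : ∀ i j k, i ≠ j → j ≠ k → i ≠ k → LinearIndependent ℂ ![lin (A i), lin (A j), lin (A k)])
    (a b c : MvPolynomial (Fin 3) ℂ) (ha : a.IsHomogeneous 3) (hb : b.IsHomogeneous 3)
    (hc : c.IsHomogeneous 3) (hD : der a b c (∏ i, lin (A i)) = 0) :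
    a = 0 ∧ b = 0 ∧ c = 0 := by
  have hd : ∀ i j k, i ≠ j → j ≠ k → i ≠ k → dt (A i) (A j) (A k) ≠ 0 :=
    fun i j k h1 h2 h3 => dt_ne (hA i j k h1 h2 h3)
  have hl0 : ∀ i, lin (A i) ≠ 0 := by
    intro i
    obtain ⟨j, k, h1, h2, h3⟩ : ∃ j k : Fin 6, i ≠ j ∧ j ≠ k ∧ i ≠ k := by
      revert i; decide
    exact (hA i j k h1 h2 h3).ne_zero 0
  have hex : ∀ k, ∃ h : MvPolynomial (Fin 3) ℂ, h.IsHomogeneous 2 ∧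
      der a b c (lin (A k)) = lin (A k) * h := by
    intro k
    obtain ⟨h, hh⟩ := exists_factor A hA a b c hD k
    refine ⟨_, homogeneousComponent_isHomogeneous 2 h, factor_homog (lin_homog _) ?_ hh⟩
    rw [der_lin]
    exact ((ha.C_mul _).add (hb.C_mul _)).add (hc.C_mul _)
  choose h hh2 hh using hex
  have hsum : ∑ i, h i = 0 := by
    have := der_prod a b c _ h hh
    rw [hD] at this
    have hp : ∏ i, lin (A i) ≠ 0 := Finset.prod_ne_zero_iff.2 fun i _ => hl0 i
    simpa [hp] using this.symm
  have hnode : ∀ i j k m, i ≠ j → i ≠ k → i ≠ m → j ≠ k → j ≠ m →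
      eval (cr (A i) (A j)) (h k - h m) = 0 := by
    intro i j k m hij hik him hjk hjm
    have hev : ∀ n, A n 0 * eval (cr (A i) (A j)) a + A n 1 * eval (cr (A i) (A j)) b
        + A n 2 * eval (cr (A i) (A j)) c =
        dt (A i) (A j) (A n) * eval (cr (A i) (A j)) (h n) := by
      intro n
      have := congrArg (eval (cr (A i) (A j))) (hh n)
      rw [der_lin, map_mul, eval_lin] at this
      simp only [map_add, map_mul, eval_C] at this
      rw [this]
      simp [cr, dt]
      left; ring
    have e1 := hev i
    have e2 := hev j
    have e3 := hev k
    have e4 := hev m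
    have z1 : dt (A i) (A j) (A i) = 0 := by simp only [dt]; ring
    have z2 : dt (A i) (A j) (A j) = 0 := by simp only [dt]; ring
    rw [z1, zero_mul] at e1
    rw [z2, zero_mul] at e2
    have dk := hd i j k hij hjk hik
    have dm := hd i j m hij hjm him
    rw [map_sub]
    have : dt (A i) (A j) (A k) * dt (A i) (A j) (A m) *
        (eval (cr (A i) (A j)) (h k) - eval (cr (A i) (A j)) (h m)) = 0 := by
      have : dt (A i) (A j) (A k) * dt (A i) (A j) (A m) *
        (eval (cr (A i) (A j)) (h k) - eval (cr (A i) (A j)) (h m)) =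
        dt (A i) (A j) (A m) * (dt (A i) (A j) (A k) * eval (cr (A i) (A j)) (h k)) -
        dt (A i) (A j) (A k) * (dt (A i) (A j) (A m) * eval (cr (A i) (A j)) (h m)) := by ring
      rw [this, ← e3, ← e4]
      have g1 : A i 0 * (A k 1 * A m 2 - A k 2 * A m 1) - A i 1 * (A k 0 * A m 2 - A k 2 * A m 0)
        + A i 2 * (A k 0 * A m 1 - A k 1 * A m 0) = dt (A i) (A k) (A m) := by
        simp only [dt]
      have g2 : A j 0 * (A k 1 * A m 2 - A k 2 * A m 1) - A j 1 * (A k 0 * A m 2 - A k 2 * A m 0)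
        + A j 2 * (A k 0 * A m 1 - A k 1 * A m 0) = dt (A j) (A k) (A m) := by
        simp only [dt]
      generalize eval (cr (A i) (A j)) a = a' at *
      generalize eval (cr (A i) (A j)) b = b' at *
      generalize eval (cr (A i) (A j)) c = c' at *
      simp only [dt] at *
      linear_combination
        (-(A j 0 * (A k 1 * A m 2 - A k 2 * A m 1) - A j 1 * (A k 0 * A m 2 - A k 2 * A m 0)
        + A j 2 * (A k 0 * A m 1 - A k 1 * A m 0))) * e1 +
        (A i 0 * (A k 1 * A m 2 - A k 2 * A m 1) - A i 1 * (A k 0 * A m 2 - A k 2 * A m 0)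
        + A i 2 * (A k 0 * A m 1 - A k 1 * A m 0)) * e2
    simpa [dk, dm] using this
  have heq : ∀ k, k ≠ 0 → h 0 - h k = 0 := by
    intro k hk
    obtain ⟨p, q, r, s, hpq, hpr, hps, hqr, hqs, hrs, hp0, hq0, hr0, hs0, hpk, hqk, hrk, hsk⟩ :
      ∃ p q r s : Fin 6, p ≠ q ∧ p ≠ r ∧ p ≠ s ∧ q ≠ r ∧ q ≠ s ∧ r ≠ s ∧
        p ≠ 0 ∧ q ≠ 0 ∧ r ≠ 0 ∧ s ≠ 0 ∧ p ≠ k ∧ q ≠ k ∧ r ≠ k ∧ s ≠ k := by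
      fin_cases k
      · exact absurd rfl hk
      · exact ⟨2, 3, 4, 5, by decide⟩
      · exact ⟨1, 3, 4, 5, by decide⟩
      · exact ⟨1, 2, 4, 5, by decide⟩
      · exact ⟨1, 2, 3, 5, by decide⟩
      · exact ⟨1, 2, 3, 4, by decide⟩
    exact quad_zero ((hh2 0).sub (hh2 k)) (A p) (A q) (A r) (A s)
      (hd _ _ _ hpq hqr hpr) (hd _ _ _ hpq hqs hps) (hd _ _ _ hpr hrs hps) (hd _ _ _ hqr hrs hqs)
      (hnode _ _ _ _ hpq hp0 hpk hq0 hqk) (hnode _ _ _ _ hpr hp0 hpk hr0 hrk)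
      (hnode _ _ _ _ hqr hq0 hqk hr0 hrk) (hnode _ _ _ _ hps hp0 hpk hs0 hsk)
      (hnode _ _ _ _ hqs hq0 hqk hs0 hsk) (hnode _ _ _ _ hrs hr0 hrk hs0 hsk)
  have h00 : h 0 = 0 := by
    rw [Fin.sum_univ_six] at hsum
    have : (6 : MvPolynomial (Fin 3) ℂ) * h 0 = 0 := by
      linear_combination hsum + heq 1 (by decide) + heq 2 (by decide) + heq 3 (by decide)
        + heq 4 (by decide) + heq 5 (by decide)
    simpa using this
  have hk0 : ∀ k, C (A k 0) * a + C (A k 1) * b + C (A k 2) * c = 0 := by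
    intro k
    rw [← der_lin, hh]
    have : h k = 0 := by
      by_cases hk : k = 0
      · rw [hk, h00]
      · have := heq k hk
        rw [h00] at this
        simpa using this
    rw [this, mul_zero]
  have e0 := hk0 0
  have e1 := hk0 1
  have e2 := hk0 2
  have d := hd 0 1 2 (by decide) (by decide) (by decide)
  have dC : (C (dt (A 0) (A 1) (A 2)) : MvPolynomial (Fin 3) ℂ) ≠ 0 := by simpa using d
  refine ⟨(mul_eq_zero.1 (?_ : C (dt (A 0) (A 1) (A 2)) * a = 0)).resolve_left dC,
    (mul_eq_zero.1 (?_ : C (dt (A 0) (A 1) (A 2)) * b = 0)).resolve_left dC,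
    (mul_eq_zero.1 (?_ : C (dt (A 0) (A 1) (A 2)) * c = 0)).resolve_left dC⟩
  all_goals simp only [dt, map_add, map_sub, map_mul]
  · linear_combination (C (A 1 1) * C (A 2 2) - C (A 1 2) * C (A 2 1)) * e0
      - (C (A 0 1) * C (A 2 2) - C (A 0 2) * C (A 2 1)) * e1
      + (C (A 0 1) * C (A 1 2) - C (A 0 2) * C (A 1 1)) * e2
  · linear_combination -(C (A 1 0) * C (A 2 2) - C (A 1 2) * C (A 2 0)) * e0
      + (C (A 0 0) * C (A 2 2) - C (A 0 2) * C (A 2 0)) * e1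
      - (C (A 0 0) * C (A 1 2) - C (A 0 2) * C (A 1 0)) * e2
  · linear_combination (C (A 1 0) * C (A 2 1) - C (A 1 1) * C (A 2 0)) * e0
      - (C (A 0 0) * C (A 2 1) - C (A 0 1) * C (A 2 0)) * e1
      + (C (A 0 0) * C (A 1 1) - C (A 0 1) * C (A 1 0)) * e2

lemma upper (A : Fin 6 → Fin 3 → ℂ)
    (hA : ∀ i j k, i ≠ j → j ≠ k → i ≠ k → LinearIndependent ℂ ![lin (A i), lin (A j), lin (A k)]) :
    ∃ a b c : MvPolynomial (Fin 3) ℂ,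
      a.IsHomogeneous 4 ∧ b.IsHomogeneous 4 ∧ c.IsHomogeneous 4 ∧
      ¬ (a = 0 ∧ b = 0 ∧ c = 0) ∧ der a b c (∏ i, lin (A i)) = 0 := by
  have hd : dt (A 0) (A 1) (A 2) ≠ 0 := dt_ne (hA 0 1 2 (by decide) (by decide) (by decide))
  have hl0 : ∀ i, lin (A i) ≠ 0 := by
    intro i
    obtain ⟨j, k, h1, h2, h3⟩ : ∃ j k : Fin 6, i ≠ j ∧ j ≠ k ∧ i ≠ k := by
      revert i; decide
    exact (hA i j k h1 h2 h3).ne_zero 0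
  obtain ⟨v, hv⟩ : ∃ v, v = cr (A 0) (A 1) := ⟨_, rfl⟩
  let w : Fin 6 → ℂ := fun k => v 0 * A k 0 + v 1 * A k 1 + v 2 * A k 2
  have hw : ∀ k, (C (w k) : MvPolynomial (Fin 3) ℂ) =
      C (v 0) * C (A k 0) + C (v 1) * C (A k 1) + C (v 2) * C (A k 2) := by
    intro k; simp [w]
  have w0 : w 0 = 0 := by simp [w, hv, cr]; ring
  have w1 : w 1 = 0 := by simp [w, hv, cr]; ring
  have w2 : w 2 = dt (A 0) (A 1) (A 2) := by simp [w, hv, cr, dt]; ring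
  let l : Fin 6 → MvPolynomial (Fin 3) ℂ := fun i => lin (A i)
  have hl : ∀ i, (l i).IsHomogeneous 1 := fun i => lin_homog _
  have hll : ∀ i, lin (A i) = l i := fun i => rfl
  have hle : ∀ i, l i = C (A i 0) * X 0 + C (A i 1) * X 1 + C (A i 2) * X 2 := fun i => rfl
  obtain ⟨P, hP⟩ : ∃ P, P = l 2 * l 3 * l 4 * l 5 := ⟨_, rfl⟩
  obtain ⟨H, hH⟩ : ∃ H, H = C (w 2) * (l 3 * l 4 * l 5) + C (w 3) * (l 2 * l 4 * l 5) +
    C (w 4) * (l 2 * l 3 * l 5) + C (w 5) * (l 2 * l 3 * l 4) := ⟨_, rfl⟩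
  have hPh : P.IsHomogeneous 4 := by
    rw [hP]; exact (((hl 2).mul (hl 3)).mul (hl 4)).mul (hl 5)
  have hHh : H.IsHomogeneous 3 := by
    rw [hH]
    have t : ∀ i j k, (l i * l j * l k).IsHomogeneous 3 := fun i j k =>
      ((hl i).mul (hl j)).mul (hl k)
    exact ((((t _ _ _).C_mul _).add ((t _ _ _).C_mul _)).add ((t _ _ _).C_mul _)).add
      ((t _ _ _).C_mul _)
  have h6 : (C (1 / 6 : ℂ) : MvPolynomial (Fin 3) ℂ) * 6 = 1 := by
    have : (6 : MvPolynomial (Fin 3) ℂ) = C 6 := (map_ofNat C 6).symm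
    rw [this, ← C_mul]; norm_num
  have hh : ∀ i, (C (v i) * P - C (1 / 6 : ℂ) * (H * X i)).IsHomogeneous 4 := fun i =>
    (hPh.C_mul _).sub ((hHh.mul (isHomogeneous_X ℂ i)).C_mul _)
  have hder : ∀ k, der (C (v 0) * P - C (1 / 6 : ℂ) * (H * X 0))
      (C (v 1) * P - C (1 / 6 : ℂ) * (H * X 1))
      (C (v 2) * P - C (1 / 6 : ℂ) * (H * X 2)) (l k) = C (w k) * P - C (1 / 6 : ℂ) * H * l k := by
    intro k
    rw [← hll, der_lin, hw, hll, hle]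
    ring
  refine ⟨_, _, _, hh 0, hh 1, hh 2, ?_, ?_⟩
  · rintro ⟨h0, h1, h2⟩
    have e := hder 0
    rw [h0, h1, h2, w0] at e
    have hH0 : H = 0 := by
      have e' : H * l 0 = 0 := by
        have : der 0 0 0 (l 0) = 0 := by simp [der_apply]
        rw [this] at e
        simp only [map_zero] at e
        linear_combination (-H * l 0) * h6 + 6 * e
      exact (mul_eq_zero.1 e').resolve_right (hl0 0)
    have hP0 : P ≠ 0 := by
      rw [hP]
      exact mul_ne_zero (mul_ne_zero (mul_ne_zero (hl0 2) (hl0 3)) (hl0 4)) (hl0 5)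
    rw [hH0] at h0 h1 h2
    simp [hP0] at h0 h1 h2
    apply hd
    rw [← w2]
    simp [w, h0, h1, h2]
  · have hfac := der_prod (C (v 0) * P - C (1 / 6 : ℂ) * (H * X 0))
      (C (v 1) * P - C (1 / 6 : ℂ) * (H * X 1))
      (C (v 2) * P - C (1 / 6 : ℂ) * (H * X 2)) l
      ![-C (1 / 6 : ℂ) * H, -C (1 / 6 : ℂ) * H,
        C (w 2) * (l 3 * l 4 * l 5) - C (1 / 6 : ℂ) * H,
        C (w 3) * (l 2 * l 4 * l 5) - C (1 / 6 : ℂ) * H,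
        C (w 4) * (l 2 * l 3 * l 5) - C (1 / 6 : ℂ) * H,
        C (w 5) * (l 2 * l 3 * l 4) - C (1 / 6 : ℂ) * H] (by
        intro i
        rw [hder, hP]
        fin_cases i
        · change C (w 0) * _ - _ * l 0 = l 0 * (-C (1 / 6 : ℂ) * H)
          rw [w0, map_zero]; ring
        · change C (w 1) * _ - _ * l 1 = l 1 * (-C (1 / 6 : ℂ) * H)
          rw [w1, map_zero]; ring
        · change C (w 2) * _ - _ * l 2 = l 2 * (C (w 2) * (l 3 * l 4 * l 5) - C (1 / 6 : ℂ) * H)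
          ring
        · change C (w 3) * _ - _ * l 3 = l 3 * (C (w 3) * (l 2 * l 4 * l 5) - C (1 / 6 : ℂ) * H)
          ring
        · change C (w 4) * _ - _ * l 4 = l 4 * (C (w 4) * (l 2 * l 3 * l 5) - C (1 / 6 : ℂ) * H)
          ring
        · change C (w 5) * _ - _ * l 5 = l 5 * (C (w 5) * (l 2 * l 3 * l 4) - C (1 / 6 : ℂ) * H)
          ring)
    refine hfac.trans ?_
    rw [Fin.sum_univ_six]
    apply mul_eq_zero_of_left
    change -C (1 / 6 : ℂ) * H + -C (1 / 6 : ℂ) * H +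
        (C (w 2) * (l 3 * l 4 * l 5) - C (1 / 6 : ℂ) * H) +
        (C (w 3) * (l 2 * l 4 * l 5) - C (1 / 6 : ℂ) * H) +
        (C (w 4) * (l 2 * l 3 * l 5) - C (1 / 6 : ℂ) * H) +
        (C (w 5) * (l 2 * l 3 * l 4) - C (1 / 6 : ℂ) * H) = 0
    linear_combination (-1 : MvPolynomial (Fin 3) ℂ) * hH - H * h6

end SixLines


/-- For a generic arrangement of six lines (no three concurrent, hence only 15 nodes),
the minimal degree of a Jacobian relation of g = ℓ₁⋯ℓ₆ equals 4. -/
theorem generic_six_lines_mdr_four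
    (li : Fin 6 → MvPolynomial (Fin 3) ℂ)
    (hhom : ∀ i, (li i).IsHomogeneous 1)
    (hgen : ∀ i j k : Fin 6, i ≠ j → j ≠ k → i ≠ k →
      LinearIndependent ℂ ![li i, li j, li k])
    (g : MvPolynomial (Fin 3) ℂ) (hg : g = ∏ i, li i) :
    (∃ a b c : MvPolynomial (Fin 3) ℂ,
      a.IsHomogeneous 4 ∧ b.IsHomogeneous 4 ∧ c.IsHomogeneous 4 ∧
      ¬ (a = 0 ∧ b = 0 ∧ c = 0) ∧
      a * pderiv 0 g + b * pderiv 1 g + c * pderiv 2 g = 0) ∧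
    (∀ r : ℕ, r ≤ 3 → ∀ a b c : MvPolynomial (Fin 3) ℂ,
      a.IsHomogeneous r → b.IsHomogeneous r → c.IsHomogeneous r →
      a * pderiv 0 g + b * pderiv 1 g + c * pderiv 2 g = 0 →
      a = 0 ∧ b = 0 ∧ c = 0) := by
  choose A hA using fun i => SixLines.exists_lin (hhom i)
  obtain rfl : li = fun i => SixLines.lin (A i) := funext hA
  subst hg
  refine ⟨?_, ?_⟩
  · obtain ⟨a, b, c, ha, hb, hc, hne, h⟩ := SixLines.upper A hgen
    exact ⟨a, b, c, ha, hb, hc, hne, by rwa [SixLines.der_apply] at h⟩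
  · intro r hr a b c ha hb hc h
    have hX : ∀ f : MvPolynomial (Fin 3) ℂ, f.IsHomogeneous r →
        (X 0 ^ (3 - r) * f).IsHomogeneous 3 := by
      intro f hf
      have := (isHomogeneous_X_pow (R := ℂ) (0 : Fin 3) (3 - r)).mul hf
      rwa [Nat.sub_add_cancel hr] at this
    have := SixLines.lower A hgen _ _ _ (hX a ha) (hX b hb) (hX c hc) (by
      rw [SixLines.der_apply]
      linear_combination X 0 ^ (3 - r) * h)
    simpa using this
end
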